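/- With probability at least 1 − δ, the regret of the UCBVI-BF algorithm after K episodes satisfies Regret(K) ≤ 30·H·L·√(S·A·K) + 2500·H²·S²·A·L² + 4·H^{3/2}·√(K·L), where L = ln(5·H·S·A·T/δ) and T = K·H. -/

import Mathlib

open scoped Classical

section UCBVI

variable {S A : Type*} [Fintype S] [Fintype A] [DecidableEq S] [DecidableEq A]
  [Nonempty S] [Nonempty A]

/-- Maximum of a real-valued function over the finite nonempty action space. -/
noncomputable def maxA (f : A → ℝ) : ℝ :=
  Finset.univ.sup' Finset.univ_nonempty f

/-- A fixed maximizer of a real-valued function over the finite nonempty action space. -/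
noncomputable def argmaxA (f : A → ℝ) : A :=
  (Finset.exists_max_image Finset.univ f
    ⟨Classical.arbitrary A, Finset.mem_univ _⟩).choose

/-- Optimistic Q-values computed by backward value iteration within one episode, indexed by
the number of remaining steps: index `j + 1` corresponds to step `h = H − j` (so index `H`
is step `1`), `Qiter … 0 = 0` plays the role of step `H + 1`, and
`V_{k,h+1}(y) = maxA (Qiter … j y ·)`.  `Qprev` are the Q-values of the previous episode
(same indexing), `Nk` the visit counts, `Phat` the empirical transition probabilities, and
`bonus j V x a` the exploration bonus at step `h = H − j` given the next-step value
estimates `V = V_{k,h+1}`.  For visited pairs,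
`Q_{k,h}(x,a) = min (Q_{k−1,h}(x,a)) (min H (R x a + ∑_y P̂(y|x,a)·V_{k,h+1}(y) + b))`;
unvisited pairs get value `H`. -/
noncomputable def Qiter (R : S → A → ℝ) (Phat : S → A → S → ℝ) (Nk : S → A → ℕ)
    (Qprev : ℕ → S → A → ℝ) (H : ℕ) (bonus : ℕ → (S → ℝ) → S → A → ℝ) :
    ℕ → S → A → ℝ
  | 0 => fun _ _ => 0
  | j + 1 => fun x a =>
      if Nk x a = 0 then (H : ℝ)
      else
        min (Qprev (j + 1) x a) (min (H : ℝ)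
          (R x a
            + (∑ y, Phat x a y * maxA (fun b => Qiter R Phat Nk Qprev H bonus j y b))
            + bonus j (fun y => maxA (fun b => Qiter R Phat Nk Qprev H bonus j y b)) x a))

/-- The learner's state before episode `k` (episodes are 0-indexed): visit counts
`N_k(x,a)`, transition counts `N_k(x,a,y)`, per-position state visit counts
(`Npos p y` = number of visits to `y` at trajectory position `p`, i.e. step `p + 1`, in
episodes `< k`), and the Q-values of the previous episode (initialized to the constant
`H`).  The trajectories are `ω : Fin K → Fin (H+1) → S` (`ω k p` = state at position `p`,
i.e. step `p + 1`, of episode `k`); in episode `k` the action at position `p < H` is the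
greedy action w.r.t. the Q-values computed from the data of episodes `< k`, and the counts
are updated accordingly.  The generic argument `bonus N Phat Npos j V x a` builds the
exploration bonus from the current statistics. -/
noncomputable def epState (R : S → A → ℝ) (H K : ℕ)
    (bonus : (S → A → ℕ) → (S → A → S → ℝ) → (ℕ → S → ℕ) → ℕ → (S → ℝ) → S → A → ℝ)
    (ω : Fin K → Fin (H + 1) → S) :
    ℕ → (S → A → ℕ) × (S → A → S → ℕ) × (ℕ → S → ℕ) × (ℕ → S → A → ℝ)
  | 0 => (fun _ _ => 0, fun _ _ _ => 0, fun _ _ => 0, fun _ _ _ => (H : ℝ))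
  | k + 1 =>
      let st := epState R H K bonus ω k
      if hk : k < K then
        let N := st.1
        let Nt := st.2.1
        let Npos := st.2.2.1
        let Qp := st.2.2.2
        let Phat := fun x a y => (Nt x a y : ℝ) / (N x a : ℝ)
        let Q := Qiter R Phat N Qp H (bonus N Phat Npos)
        let act : Fin H → A := fun p =>
          argmaxA (fun a => Q (H - p.val) (ω ⟨k, hk⟩ p.castSucc) a)
        ( fun x a => N x a + (Finset.univ.filter
            (fun p : Fin H => ω ⟨k, hk⟩ p.castSucc = x ∧ act p = a)).card,
          fun x a y => Nt x a y + (Finset.univ.filter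
            (fun p : Fin H =>
              ω ⟨k, hk⟩ p.castSucc = x ∧ act p = a ∧ ω ⟨k, hk⟩ p.succ = y)).card,
          fun q y => Npos q y
            + if hq : q < H + 1 then (if ω ⟨k, hk⟩ ⟨q, hq⟩ = y then 1 else 0) else 0,
          Q )
      else st

/-- The Q-values `Q_{k,·}` used during (0-indexed) episode `k`, indexed by remaining steps
`j = H + 1 − h`. -/
noncomputable def Qep (R : S → A → ℝ) (H K : ℕ)
    (bonus : (S → A → ℕ) → (S → A → S → ℝ) → (ℕ → S → ℕ) → ℕ → (S → ℝ) → S → A → ℝ)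
    (ω : Fin K → Fin (H + 1) → S) (k : ℕ) : ℕ → S → A → ℝ :=
  (epState R H K bonus ω (k + 1)).2.2.2

/-- The greedy policy `π_k` followed in episode `k`, as a function of the number of
remaining steps `j = H + 1 − h`: `π_k` at step `h` plays `argmax_a Q_{k,h}(x,a)`. -/
noncomputable def polep (R : S → A → ℝ) (H K : ℕ)
    (bonus : (S → A → ℕ) → (S → A → S → ℝ) → (ℕ → S → ℕ) → ℕ → (S → ℝ) → S → A → ℝ)
    (ω : Fin K → Fin (H + 1) → S) (k : ℕ) : ℕ → S → A :=
  fun j x => argmaxA (fun a => Qep R H K bonus ω k j x a)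

/-- Value function `V^π` of a policy `π` given as a function of remaining steps:
`VpolJ P R π j x` is the expected sum of the next `j` rewards, so
`V^π_1 = VpolJ P R π H` for horizon `H`. -/
noncomputable def VpolJ (P : S → A → S → ℝ) (R : S → A → ℝ) (π : ℕ → S → A) :
    ℕ → S → ℝ
  | 0 => fun _ => 0
  | j + 1 => fun x =>
      R x (π (j + 1) x) + ∑ y, P x (π (j + 1) x) y * VpolJ P R π j y

/-- Optimal value function indexed by remaining steps: `V*_1 = VstarJ P R H`. -/
noncomputable def VstarJ (P : S → A → S → ℝ) (R : S → A → ℝ) : ℕ → S → ℝ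
  | 0 => fun _ => 0
  | j + 1 => fun x =>
      maxA (fun a => R x a + ∑ y, P x a y * VstarJ P R j y)

/-- Regret of the UCBVI learner over `K` episodes with initial states `xinit`:
`Regret(K) = ∑_k [V*_1(x_{k,1}) − V^{π_k}_1(x_{k,1})]`. -/
noncomputable def ucbviRegret (P : S → A → S → ℝ) (R : S → A → ℝ) (H K : ℕ)
    (bonus : (S → A → ℕ) → (S → A → S → ℝ) → (ℕ → S → ℕ) → ℕ → (S → ℝ) → S → A → ℝ)
    (xinit : Fin K → S) (ω : Fin K → Fin (H + 1) → S) : ℝ :=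
  ∑ k : Fin K,
    (VstarJ P R H (xinit k) - VpolJ P R (polep R H K bonus ω k.val) H (xinit k))

/-- Probability of the full interaction history `ω`: each episode `k` starts at the
prescribed state `xinit k` and evolves by `P` under the greedy actions of episode `k`. -/
noncomputable def trajProb (P : S → A → S → ℝ) (R : S → A → ℝ) (H K : ℕ)
    (bonus : (S → A → ℕ) → (S → A → S → ℝ) → (ℕ → S → ℕ) → ℕ → (S → ℝ) → S → A → ℝ)
    (xinit : Fin K → S) (ω : Fin K → Fin (H + 1) → S) : ℝ :=
  ∏ k : Fin K,
    ((if ω k 0 = xinit k then (1 : ℝ) else 0) *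
      ∏ p : Fin H,
        P (ω k p.castSucc)
          (polep R H K bonus ω k.val (H - p.val) (ω k p.castSucc))
          (ω k p.succ))

/-- The Bernstein–Freedman exploration bonus of UCBVI-BF:
`b_{k,h}(x,a) = √(8·L'·Var_{Y∼P̂_k(·|x,a)}(V_{k,h+1}(Y)) / N_k(x,a))
  + 14·H·L'/(3·N_k(x,a))
  + √(8·∑_y P̂_k(y|x,a)·min(100²·H³·S²·A·L'² / N'_{k,h+1}(y), H²) / N_k(x,a))`
with `L' = ln(5·S·A·T/δ)`; the first argument `j` of the bonus encodes the step
`h = H − j`, so that `N'_{k,h+1}(y)` is the visit count of `y` at trajectory position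
`h + 1 − 1 = H − j`; when `N'_{k,h+1}(y) = 0` the `min` equals `H²`. -/
noncomputable def bonusBF (H Scard Acard : ℕ) (L' : ℝ) :
    (S → A → ℕ) → (S → A → S → ℝ) → (ℕ → S → ℕ) → ℕ → (S → ℝ) → S → A → ℝ :=
  fun N Phat Npos j V x a =>
    Real.sqrt (8 * L' * (∑ y, Phat x a y * V y ^ 2 - (∑ y, Phat x a y * V y) ^ 2)
        / (N x a : ℝ))
    + 14 * (H : ℝ) * L' / (3 * (N x a : ℝ))
    + Real.sqrt (8 * (∑ y, Phat x a y *
          (if Npos (H - j) y = 0 then (H : ℝ) ^ 2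
            else min (100 ^ 2 * (H : ℝ) ^ 3 * (Scard : ℝ) ^ 2 * (Acard : ℝ) * L' ^ 2
                / (Npos (H - j) y : ℝ)) ((H : ℝ) ^ 2)))
        / (N x a : ℝ))

end UCBVI

section Abstract

/-- Resampling one coordinate averages over that coordinate. -/
lemma sum_sum_update {K : ℕ} {T : Type*} [Fintype T] (m : Fin K) (F : (Fin K → T) → ℝ) :
    ∑ ω, ∑ τ, F (Function.update ω m τ) = (Fintype.card T : ℝ) * ∑ ω, F ω := by
  let e' : (Fin K → T) × T ≃ (Fin K → T) × T :=
    { toFun := fun z => (Function.update z.1 m z.2, z.1 m)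
      invFun := fun z => (Function.update z.1 m z.2, z.1 m)
      left_inv := fun z => by simp
      right_inv := fun z => by simp }
  rw [← Fintype.sum_prod_type' (f := fun ω τ => F (Function.update ω m τ)),
    ← Equiv.sum_comp e' (fun z => F (Function.update z.1 m z.2))]
  simp [e', Fintype.sum_prod_type, Finset.mul_sum]

lemma sum_prod_adapted_step {K : ℕ} {T : Type*} [Fintype T]
    (f : Fin K → (Fin K → T) → ℝ)
    (hadapt : ∀ k m : Fin K, k < m → ∀ ω τ, f k (Function.update ω m τ) = f k ω)
    (m : ℕ) (hm : m < K) :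
    (Fintype.card T : ℝ) * ∑ ω, ∏ k with k.val < m + 1, f k ω
      = ∑ ω, (∏ k with k.val < m, f k ω) * ∑ τ, f ⟨m, hm⟩ (Function.update ω ⟨m, hm⟩ τ) := by
  rw [← sum_sum_update ⟨m, hm⟩]
  refine Finset.sum_congr rfl fun ω _ => ?_
  rw [Finset.mul_sum]
  refine Finset.sum_congr rfl fun τ _ => ?_
  have hs : (Finset.univ.filter fun k : Fin K => k.val < m + 1)
      = insert ⟨m, hm⟩ (Finset.univ.filter fun k : Fin K => k.val < m) := by
    ext k
    simp [Fin.ext_iff]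
    omega
  rw [hs, Finset.prod_insert (by simp), mul_comm]
  congr 1
  refine Finset.prod_congr rfl fun k hk => hadapt k _ ?_ ω τ
  exact Fin.lt_def.2 (by simpa using hk)

/-- A product of nonnegative adapted factors, each of conditional sum at most one, has
total sum at most one. -/
lemma sum_prod_adapted_le_one {K : ℕ} {T : Type*} [Fintype T] [Nonempty T]
    (f : Fin K → (Fin K → T) → ℝ) (hf : ∀ k ω, 0 ≤ f k ω)
    (hadapt : ∀ k m : Fin K, k < m → ∀ ω τ, f k (Function.update ω m τ) = f k ω)
    (h1 : ∀ m ω, ∑ τ, f m (Function.update ω m τ) ≤ 1) :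
    ∑ ω, ∏ k, f k ω ≤ 1 := by
  have hT : (0 : ℝ) < Fintype.card T := by exact_mod_cast Fintype.card_pos
  have key : ∀ m ≤ K, ∑ ω, ∏ k with k.val < m, f k ω ≤ (Fintype.card T : ℝ) ^ (K - m) := by
    intro m
    induction m with
    | zero => simp
    | succ m ih =>
      intro hm
      have h := sum_prod_adapted_step f hadapt m hm
      have h2 : ∑ ω, (∏ k with k.val < m, f k ω) * ∑ τ, f ⟨m, hm⟩ (Function.update ω ⟨m, hm⟩ τ)
          ≤ ∑ ω, ∏ k with k.val < m, f k ω := by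
        refine Finset.sum_le_sum fun ω _ => ?_
        exact mul_le_of_le_one_right (Finset.prod_nonneg fun k _ => hf k ω) (h1 _ _)
      have h3 := ih (by omega)
      have h4 : K - m = (K - (m + 1)) + 1 := by omega
      rw [h4, pow_succ] at h3
      have h5 : (Fintype.card T : ℝ) * ∑ ω, ∏ k with k.val < m + 1, f k ω
          ≤ (Fintype.card T : ℝ) * (Fintype.card T : ℝ) ^ (K - (m + 1)) := by
        rw [h]; linarith
      exact le_of_mul_le_mul_left h5 hT
  simpa using key K le_rfl

lemma sum_prod_adapted_eq_one {K : ℕ} {T : Type*} [Fintype T] [Nonempty T]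
    (f : Fin K → (Fin K → T) → ℝ)
    (hadapt : ∀ k m : Fin K, k < m → ∀ ω τ, f k (Function.update ω m τ) = f k ω)
    (h1 : ∀ m ω, ∑ τ, f m (Function.update ω m τ) = 1) :
    ∑ ω, ∏ k, f k ω = 1 := by
  have hT : (Fintype.card T : ℝ) ≠ 0 := by exact_mod_cast Fintype.card_ne_zero
  have key : ∀ m ≤ K, ∑ ω, ∏ k with k.val < m, f k ω = (Fintype.card T : ℝ) ^ (K - m) := by
    intro m
    induction m with
    | zero => simp
    | succ m ih =>
      intro hm
      have h := sum_prod_adapted_step f hadapt m hm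
      have h4 : K - m = (K - (m + 1)) + 1 := by omega
      simp only [h1, mul_one] at h
      rw [ih (by omega), h4, pow_succ, mul_comm] at h
      exact mul_right_cancel₀ hT h
  simpa using key K le_rfl

variable {S : Type*}

/-- Weight of a trajectory under time-dependent kernels indexed by remaining steps. -/
noncomputable def pathWeight (q : ℕ → S → S → ℝ) (H : ℕ) (τ : Fin (H + 1) → S) : ℝ :=
  ∏ p : Fin H, q (H - p.val) (τ p.castSucc) (τ p.succ)

/-- Additive functional of a trajectory, indexed by remaining steps. -/
noncomputable def pathSum (w : ℕ → S → S → ℝ) (H : ℕ) (τ : Fin (H + 1) → S) : ℝ :=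
  ∑ p : Fin H, w (H - p.val) (τ p.castSucc) (τ p.succ)

lemma pathWeight_cons (q : ℕ → S → S → ℝ) (H : ℕ) (x : S) (τ : Fin (H + 1) → S) :
    pathWeight q (H + 1) (Fin.cons x τ) = q (H + 1) x (τ 0) * pathWeight q H τ := by
  simp [pathWeight, Fin.prod_univ_succ]

lemma pathSum_cons (w : ℕ → S → S → ℝ) (H : ℕ) (x : S) (τ : Fin (H + 1) → S) :
    pathSum w (H + 1) (Fin.cons x τ) = w (H + 1) x (τ 0) + pathSum w H τ := by
  simp [pathSum, Fin.sum_univ_succ]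

lemma pathWeight_nonneg {q : ℕ → S → S → ℝ} (hq : ∀ j x y, 0 ≤ q j x y) (H : ℕ)
    (τ : Fin (H + 1) → S) : 0 ≤ pathWeight q H τ :=
  Finset.prod_nonneg fun _ _ => hq _ _ _

lemma pathWeight_mul_exp (q w : ℕ → S → S → ℝ) (H : ℕ) (τ : Fin (H + 1) → S) :
    pathWeight q H τ * Real.exp (pathSum w H τ)
      = pathWeight (fun j x y => q j x y * Real.exp (w j x y)) H τ := by
  unfold pathWeight pathSum
  rw [Real.exp_sum, Finset.prod_mul_distrib]

variable [Fintype S]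

/-- Expected value of `pathSum` under the kernels `q`, by backward recursion. -/
noncomputable def expSum (q w : ℕ → S → S → ℝ) : ℕ → S → ℝ
  | 0 => fun _ => 0
  | j + 1 => fun x => ∑ y, q (j + 1) x y * (w (j + 1) x y + expSum q w j y)

variable [DecidableEq S]

lemma sum_path_succ (q : ℕ → S → S → ℝ) (H : ℕ) (x : S) (F : (Fin (H + 2) → S) → ℝ) :
    ∑ τ : Fin (H + 2) → S, (if τ 0 = x then (1 : ℝ) else 0) * pathWeight q (H + 1) τ * F τ
      = ∑ y, q (H + 1) x y * ∑ τ : Fin (H + 1) → S,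
          (if τ 0 = y then (1 : ℝ) else 0) * pathWeight q H τ * F (Fin.cons x τ) := by
  rw [← Equiv.sum_comp (Fin.consEquiv fun _ : Fin (H + 2) => S), Fintype.sum_prod_type,
    Finset.sum_eq_single x]
  · simp_rw [Finset.mul_sum]
    rw [Finset.sum_comm]
    refine Finset.sum_congr rfl fun τ _ => ?_
    rw [Finset.sum_eq_single (τ 0)]
    · simp [Fin.consEquiv, pathWeight_cons, mul_assoc]
    · intro y _ hy
      simp [hy.symm]
    · simp
  · intro y _ hy
    simp [Fin.consEquiv, hy]
  · simp

lemma sum_ite_zero_path (x : S) :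
    ∑ τ : Fin (0 + 1) → S, (if τ 0 = x then (1 : ℝ) else 0) = 1 := by
  rw [← Equiv.sum_comp (Equiv.funUnique (Fin 1) S).symm]
  simp

lemma sum_path_le_one {q : ℕ → S → S → ℝ} (hq : ∀ j x y, 0 ≤ q j x y)
    (hq1 : ∀ j x, ∑ y, q j x y ≤ 1) (H : ℕ) (x : S) :
    ∑ τ : Fin (H + 1) → S, (if τ 0 = x then (1 : ℝ) else 0) * pathWeight q H τ ≤ 1 := by
  induction H generalizing x with
  | zero => simpa [pathWeight] using (sum_ite_zero_path x).le
  | succ H ih =>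
    have h := sum_path_succ q H x (fun _ => 1)
    simp only [mul_one] at h
    rw [h]
    refine le_trans (Finset.sum_le_sum fun y _ => ?_) (hq1 (H + 1) x)
    exact mul_le_of_le_one_right (hq _ _ _) (ih y)

lemma sum_path_eq_one {q : ℕ → S → S → ℝ}
    (hq1 : ∀ j x, ∑ y, q j x y = 1) (H : ℕ) (x : S) :
    ∑ τ : Fin (H + 1) → S, (if τ 0 = x then (1 : ℝ) else 0) * pathWeight q H τ = 1 := by
  induction H generalizing x with
  | zero => simpa [pathWeight] using (sum_ite_zero_path x)
  | succ H ih =>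
    have h := sum_path_succ q H x (fun _ => 1)
    simp only [mul_one] at h
    rw [h]
    simp only [ih, mul_one, hq1]

lemma sum_path_pathSum {q : ℕ → S → S → ℝ}
    (hq1 : ∀ j x, ∑ y, q j x y = 1) (w : ℕ → S → S → ℝ) (H : ℕ) (x : S) :
    ∑ τ : Fin (H + 1) → S, (if τ 0 = x then (1 : ℝ) else 0) * pathWeight q H τ * pathSum w H τ
      = expSum q w H x := by
  induction H generalizing x with
  | zero => simp [pathSum, expSum]
  | succ H ih =>
    rw [sum_path_succ]
    simp only [expSum]
    refine Finset.sum_congr rfl fun y _ => ?_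
    congr 1
    rw [← ih y]
    have h1 := sum_path_eq_one hq1 H y
    calc _ = ∑ τ : Fin (H + 1) → S, ((if τ 0 = y then (1 : ℝ) else 0) * pathWeight q H τ
              * w (H + 1) x y
            + (if τ 0 = y then (1 : ℝ) else 0) * pathWeight q H τ * pathSum w H τ) := by
          refine Finset.sum_congr rfl fun τ _ => ?_
          rw [pathSum_cons]
          split_ifs with h
          · subst h; ring
          · simp
      _ = _ := by rw [Finset.sum_add_distrib, ← Finset.sum_mul, h1, one_mul]

/-- Exponential lower-tail bound for a bounded nonnegative additive functional. -/
lemma sum_path_exp_le_one {q w : ℕ → S → S → ℝ} (hq : ∀ j x y, 0 ≤ q j x y)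
    (hq1 : ∀ j x, ∑ y, q j x y = 1) (H : ℕ) (x : S)
    (hw0 : ∀ τ, 0 ≤ pathSum w H τ) (hw1 : ∀ τ, pathSum w H τ ≤ 1) :
    ∑ τ : Fin (H + 1) → S, (if τ 0 = x then (1 : ℝ) else 0) * pathWeight q H τ
      * Real.exp (5 / 8 * expSum q w H x - pathSum w H τ) ≤ 1 := by
  have hexp : ∀ t : ℝ, 0 ≤ t → t ≤ 1 → Real.exp (-t) ≤ 1 - 5 / 8 * t := by
    intro t h0 h1
    have hc := convexOn_exp.2 (Set.mem_univ (0 : ℝ)) (Set.mem_univ (-1 : ℝ))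
      (by linarith : 0 ≤ 1 - t) h0 (by ring)
    have he : Real.exp (-1) ≤ 3 / 8 := by
      rw [Real.exp_neg]
      have := Real.exp_one_gt_d9
      rw [inv_le_comm₀ (Real.exp_pos _) (by norm_num)]
      linarith
    simp only [smul_eq_mul, mul_zero, zero_add, mul_neg, mul_one, Real.exp_zero] at hc
    nlinarith
  have hb : ∑ τ : Fin (H + 1) → S, (if τ 0 = x then (1 : ℝ) else 0) * pathWeight q H τ
      * Real.exp (- pathSum w H τ) ≤ 1 - 5 / 8 * expSum q w H x := by
    rw [← sum_path_pathSum hq1 w H x]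
    nth_rewrite 2 [← sum_path_eq_one hq1 H x]
    rw [Finset.mul_sum, ← Finset.sum_sub_distrib]
    refine Finset.sum_le_sum fun τ _ => ?_
    have h0 : 0 ≤ (if τ 0 = x then (1 : ℝ) else 0) * pathWeight q H τ :=
      mul_nonneg (by split_ifs <;> norm_num) (pathWeight_nonneg hq H τ)
    have := mul_le_mul_of_nonneg_left (hexp _ (hw0 τ) (hw1 τ)) h0
    linarith
  calc _ = Real.exp (5 / 8 * expSum q w H x) * ∑ τ : Fin (H + 1) → S,
          (if τ 0 = x then (1 : ℝ) else 0) * pathWeight q H τ * Real.exp (- pathSum w H τ) := by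
        rw [Finset.mul_sum]
        refine Finset.sum_congr rfl fun τ _ => ?_
        rw [sub_eq_add_neg, Real.exp_add]; ring
    _ ≤ Real.exp (5 / 8 * expSum q w H x) * Real.exp (-(5 / 8 * expSum q w H x)) := by
        refine mul_le_mul_of_nonneg_left (hb.trans ?_) (Real.exp_pos _).le
        have := Real.add_one_le_exp (-(5 / 8 * expSum q w H x))
        linarith
    _ = 1 := by rw [← Real.exp_add]; simp

end Abstract

section Interaction

variable {S A : Type*} [Fintype S] [Fintype A] [DecidableEq S] [DecidableEq A]
  [Nonempty A]
  (P : S → A → S → ℝ) (R : S → A → ℝ) (H K : ℕ)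
  (bonus : (S → A → ℕ) → (S → A → S → ℝ) → (ℕ → S → ℕ) → ℕ → (S → ℝ) → S → A → ℝ)
  (xinit : Fin K → S) (ω : Fin K → Fin (H + 1) → S)

/-- Visit counts `N_k(x,a)`. -/
noncomputable def visits (k : ℕ) (x : S) (a : A) : ℕ := (epState R H K bonus ω k).1 x a

/-- Transition counts `N_k(x,a,y)`. -/
noncomputable def transitions (k : ℕ) (x : S) (a : A) (y : S) : ℕ :=
  (epState R H K bonus ω k).2.1 x a y

/-- Visit counts of a state at a trajectory position. -/
noncomputable def posVisits (k q : ℕ) (y : S) : ℕ := (epState R H K bonus ω k).2.2.1 q y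

/-- Empirical transition probabilities before episode `k`. -/
noncomputable def empP (k : ℕ) (x : S) (a : A) (y : S) : ℝ :=
  (transitions R H K bonus ω k x a y : ℝ) / (visits R H K bonus ω k x a : ℝ)

/-- Transition kernel of episode `k` under the greedy policy, indexed by remaining steps. -/
noncomputable def epKernel (k : ℕ) (j : ℕ) (x y : S) : ℝ :=
  P x (polep R H K bonus ω k j x) y

lemma epState_update (m : Fin K) (τ : Fin (H + 1) → S) (k : ℕ) (hk : k ≤ m.val) :
    epState R H K bonus (Function.update ω m τ) k = epState R H K bonus ω k := by
  induction k with
  | zero => rfl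
  | succ k ih =>
    have hkK : k < K := by omega
    have hne : (⟨k, hkK⟩ : Fin K) ≠ m := by
      intro h
      have := congrArg Fin.val h
      simp at this
      omega
    have hup : Function.update ω m τ ⟨k, hkK⟩ = ω ⟨k, hkK⟩ := Function.update_of_ne hne _ _
    simp only [epState, ih (by omega), hkK, dif_pos, hup]

variable {K} in
lemma Qep_eq (k : ℕ) (hk : k < K) :
    Qep R H K bonus ω k = Qiter R (empP R H K bonus ω k) (visits R H K bonus ω k)
      (epState R H K bonus ω k).2.2.2 H
      (bonus (visits R H K bonus ω k) (empP R H K bonus ω k) (posVisits R H K bonus ω k)) := by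
  simp only [Qep, epState, hk, dif_pos]
  rfl

lemma Qep_update (m : Fin K) (τ : Fin (H + 1) → S) (k : ℕ) (hk : k ≤ m.val) :
    Qep R H K bonus (Function.update ω m τ) k = Qep R H K bonus ω k := by
  have hkK : k < K := by omega
  rw [Qep_eq _ _ _ _ _ hkK, Qep_eq _ _ _ _ _ hkK]
  unfold empP visits transitions posVisits
  rw [epState_update R H K bonus ω m τ k hk]

lemma polep_update (m : Fin K) (τ : Fin (H + 1) → S) (k : ℕ) (hk : k ≤ m.val) :
    polep R H K bonus (Function.update ω m τ) k = polep R H K bonus ω k := by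
  unfold polep
  rw [Qep_update R H K bonus ω m τ k hk]

lemma epKernel_update (m : Fin K) (τ : Fin (H + 1) → S) (k : ℕ) (hk : k ≤ m.val) :
    epKernel P R H K bonus (Function.update ω m τ) k = epKernel P R H K bonus ω k := by
  unfold epKernel
  rw [polep_update R H K bonus ω m τ k hk]

/-- Probability of the trajectory of episode `k` given the previous episodes. -/
noncomputable def epProb (k : Fin K) : ℝ :=
  (if ω k 0 = xinit k then (1 : ℝ) else 0)
    * pathWeight (epKernel P R H K bonus ω k.val) H (ω k)

lemma trajProb_eq : trajProb P R H K bonus xinit ω = ∏ k, epProb P R H K bonus xinit ω k := rfl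

lemma epProb_update_self (m : Fin K) (τ : Fin (H + 1) → S) :
    epProb P R H K bonus xinit (Function.update ω m τ) m
      = (if τ 0 = xinit m then (1 : ℝ) else 0)
        * pathWeight (epKernel P R H K bonus ω m.val) H τ := by
  unfold epProb
  rw [epKernel_update P R H K bonus ω m τ _ le_rfl, Function.update_self]

lemma epProb_update_of_lt (k m : Fin K) (h : k < m) (τ : Fin (H + 1) → S) :
    epProb P R H K bonus xinit (Function.update ω m τ) k = epProb P R H K bonus xinit ω k := by
  unfold epProb
  rw [epKernel_update P R H K bonus ω m τ _ (Fin.le_def.1 h.le), Function.update_of_ne h.ne]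

variable {P} in
lemma epProb_nonneg (hP0 : ∀ x a y, 0 ≤ P x a y) (k : Fin K) :
    0 ≤ epProb P R H K bonus xinit ω k :=
  mul_nonneg (by split_ifs <;> norm_num) (pathWeight_nonneg (fun _ _ _ => hP0 _ _ _) _ _)

variable {P} in
lemma trajProb_nonneg (hP0 : ∀ x a y, 0 ≤ P x a y) :
    0 ≤ trajProb P R H K bonus xinit ω :=
  Finset.prod_nonneg fun k _ => epProb_nonneg R H K bonus xinit ω hP0 k

/-- Functional summing `φ` over the successors of visits to `(x,a)` in an episode. -/
noncomputable def hitWeight (x : S) (a : A) (φ : S → ℝ) (k : ℕ) (j : ℕ) (x' y' : S) : ℝ :=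
  if x' = x ∧ polep R H K bonus ω k j x' = a then φ y' else 0

lemma hitWeight_update (x : S) (a : A) (φ : S → ℝ) (m : Fin K) (τ : Fin (H + 1) → S) (k : ℕ)
    (hk : k ≤ m.val) :
    hitWeight R H K bonus (Function.update ω m τ) x a φ k = hitWeight R H K bonus ω x a φ k := by
  unfold hitWeight
  rw [polep_update R H K bonus ω m τ k hk]

variable {K} in
lemma visits_succ (k : ℕ) (hk : k < K) (x : S) (a : A) :
    (visits R H K bonus ω (k + 1) x a : ℝ) = visits R H K bonus ω k x a
      + pathSum (hitWeight R H K bonus ω x a (fun _ => 1) k) H (ω ⟨k, hk⟩) := by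
  have hq := Qep_eq R H bonus ω k hk
  unfold visits
  simp only [epState, hk, dif_pos]
  push_cast
  congr 1
  rw [Finset.card_filter]
  push_cast
  unfold pathSum hitWeight polep
  rw [hq]
  rfl

variable {K} in
lemma transitions_succ (k : ℕ) (hk : k < K) (x : S) (a : A) (φ : S → ℝ) :
    ∑ y, (transitions R H K bonus ω (k + 1) x a y : ℝ) * φ y
      = ∑ y, (transitions R H K bonus ω k x a y : ℝ) * φ y
      + pathSum (hitWeight R H K bonus ω x a φ k) H (ω ⟨k, hk⟩) := by
  have hq := Qep_eq R H bonus ω k hk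
  have h1 : ∀ y, (transitions R H K bonus ω (k + 1) x a y : ℝ)
      = transitions R H K bonus ω k x a y + ∑ p : Fin H,
        if ω ⟨k, hk⟩ p.castSucc = x ∧ polep R H K bonus ω k (H - p.val) (ω ⟨k, hk⟩ p.castSucc) = a
          ∧ ω ⟨k, hk⟩ p.succ = y then (1 : ℝ) else 0 := by
    intro y
    unfold transitions
    simp only [epState, hk, dif_pos]
    push_cast
    congr 1
    rw [Finset.card_filter]
    push_cast
    unfold polep
    rw [hq]
    rfl
  simp_rw [h1, add_mul, Finset.sum_add_distrib]
  congr 1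
  simp_rw [Finset.sum_mul]
  rw [Finset.sum_comm]
  unfold pathSum hitWeight
  refine Finset.sum_congr rfl fun p _ => ?_
  rw [Finset.sum_eq_single (ω ⟨k, hk⟩ p.succ)]
  · simp
  · intro y _ hy
    simp [hy.symm]
  · simp

variable {K} in
lemma sum_transitions (k : ℕ) (hk : k ≤ K) (x : S) (a : A) :
    ∑ y, (transitions R H K bonus ω k x a y : ℝ) = visits R H K bonus ω k x a := by
  induction k with
  | zero => simp [transitions, visits, epState]
  | succ k ih =>
    have h := transitions_succ R H bonus ω k hk x a (fun _ => 1)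
    simp only [mul_one] at h
    rw [h, visits_succ R H bonus ω k hk, ih (by omega)]

variable {K} in
lemma posVisits_succ (k : ℕ) (hk : k < K) (q : ℕ) (hq : q < H + 1) (y : S) :
    posVisits R H K bonus ω (k + 1) q y = posVisits R H K bonus ω k q y
      + if ω ⟨k, hk⟩ ⟨q, hq⟩ = y then 1 else 0 := by
  unfold posVisits
  simp only [epState, hk, hq, dif_pos]

variable {K} in
lemma sum_transitions_eq (k : ℕ) (hk : k ≤ K) (x : S) (a : A) (φ : S → ℝ) :
    ∑ y, (transitions R H K bonus ω k x a y : ℝ) * φ y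
      = ∑ m : Fin K, if m.val < k then
          pathSum (hitWeight R H K bonus ω x a φ m.val) H (ω m) else 0 := by
  induction k with
  | zero => simp [transitions, epState]
  | succ k ih =>
    rw [transitions_succ R H bonus ω k hk, ih (by omega)]
    have : ∀ m : Fin K, (if m.val < k + 1 then
          pathSum (hitWeight R H K bonus ω x a φ m.val) H (ω m) else 0)
        = (if m.val < k then pathSum (hitWeight R H K bonus ω x a φ m.val) H (ω m) else 0)
          + if m = ⟨k, hk⟩ then pathSum (hitWeight R H K bonus ω x a φ m.val) H (ω m) else 0 := by
      intro m
      rcases lt_trichotomy m.val k with h | h | h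
      · have h2 : m ≠ ⟨k, hk⟩ := fun hh => by simp [hh] at h
        simp [h, h2, Nat.lt_succ_of_lt h]
      · have h2 : m = ⟨k, hk⟩ := Fin.ext h
        subst h2
        simp
      · have h2 : m ≠ ⟨k, hk⟩ := fun hh => by simp [hh] at h
        have h3 : ¬ m.val < k := by omega
        have h4 : ¬ m.val < k + 1 := by omega
        simp [h2, h3, h4]
    simp_rw [this, Finset.sum_add_distrib]
    simp

variable [Nonempty S]

variable {P} in
lemma sum_trajProb (hP1 : ∀ x a, ∑ y, P x a y = 1) :
    ∑ ω, trajProb P R H K bonus xinit ω = 1 := by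
  simp_rw [trajProb_eq]
  refine sum_prod_adapted_eq_one (fun k ω => epProb P R H K bonus xinit ω k) ?_ ?_
  · intro k m h ω τ
    exact epProb_update_of_lt P R H K bonus xinit ω k m h τ
  · intro m ω
    simp_rw [epProb_update_self]
    exact sum_path_eq_one (fun j x => hP1 _ _) H _

variable {P K} in
/-- Exponential supermartingale bound for sums over the observed successors of `(x,a)`. -/
lemma sum_trajProb_exp_transitions_le (hP0 : ∀ x a y, 0 ≤ P x a y)
    (hP1 : ∀ x a, ∑ y, P x a y = 1) (x : S) (a : A) (φ : S → ℝ)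
    (hφ : ∑ y, P x a y * Real.exp (φ y) ≤ 1) (k : ℕ) (hk : k ≤ K) :
    ∑ ω, trajProb P R H K bonus xinit ω
      * Real.exp (∑ y, (transitions R H K bonus ω k x a y : ℝ) * φ y) ≤ 1 := by
  have hrw : ∀ ω, trajProb P R H K bonus xinit ω
      * Real.exp (∑ y, (transitions R H K bonus ω k x a y : ℝ) * φ y)
      = ∏ m : Fin K, epProb P R H K bonus xinit ω m * Real.exp (if m.val < k then
          pathSum (hitWeight R H K bonus ω x a φ m.val) H (ω m) else 0) := by
    intro ω
    rw [sum_transitions_eq R H bonus ω k hk, Real.exp_sum, Finset.prod_mul_distrib, trajProb_eq]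
  simp_rw [hrw]
  refine sum_prod_adapted_le_one (fun m ω => epProb P R H K bonus xinit ω m
    * Real.exp (if m.val < k then
          pathSum (hitWeight R H K bonus ω x a φ m.val) H (ω m) else 0)) ?_ ?_ ?_
  · intro m ω
    exact mul_nonneg (epProb_nonneg R H K bonus xinit ω hP0 m) (Real.exp_pos _).le
  · intro m m' h ω τ
    rw [epProb_update_of_lt P R H K bonus xinit ω m m' h τ,
      hitWeight_update R H K bonus ω x a φ m' τ _ (Fin.le_def.1 h.le), Function.update_of_ne h.ne]
  · intro m ω
    simp_rw [epProb_update_self, hitWeight_update R H K bonus ω x a φ m _ _ le_rfl,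
      Function.update_self]
    by_cases hm : m.val < k
    · simp only [hm, if_true, mul_assoc, pathWeight_mul_exp]
      refine sum_path_le_one (fun j x y => mul_nonneg (hP0 _ _ _) (Real.exp_pos _).le) ?_ H _
      intro j x'
      unfold hitWeight
      change ∑ y, P x' (polep R H K bonus ω m.val j x') y * _ ≤ 1
      by_cases h : x' = x ∧ polep R H K bonus ω m.val j x' = a
      · simp only [h]
        rw [← h.2, h.1] at hφ
        rw [← h.2, h.1]
        simpa using hφ
      · simp only [h, if_false, Real.exp_zero, mul_one, hP1, le_refl]
    · simp only [hm, if_false, Real.exp_zero, mul_one]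
      exact (sum_path_eq_one (fun j x => hP1 _ _) H _).le

variable {P} in
/-- Exponential supermartingale bound comparing expected and realized episode functionals. -/
lemma sum_trajProb_exp_episodes_le (hP0 : ∀ x a y, 0 ≤ P x a y)
    (hP1 : ∀ x a, ∑ y, P x a y = 1) (w : (Fin K → Fin (H + 1) → S) → ℕ → ℕ → S → S → ℝ)
    (hw : ∀ ω (m : Fin K) τ, ∀ k ≤ m.val, w (Function.update ω m τ) k = w ω k)
    (hw0 : ∀ ω k τ, 0 ≤ pathSum (w ω k) H τ) (hw1 : ∀ ω k τ, pathSum (w ω k) H τ ≤ 1) :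
    ∑ ω, trajProb P R H K bonus xinit ω
      * Real.exp (∑ k : Fin K, (5 / 8 * expSum (epKernel P R H K bonus ω k.val) (w ω k.val) H
          (xinit k) - pathSum (w ω k.val) H (ω k))) ≤ 1 := by
  simp_rw [Real.exp_sum, trajProb_eq, ← Finset.prod_mul_distrib]
  refine sum_prod_adapted_le_one (fun k ω => epProb P R H K bonus xinit ω k
    * Real.exp (5 / 8 * expSum (epKernel P R H K bonus ω k.val) (w ω k.val) H
          (xinit k) - pathSum (w ω k.val) H (ω k))) ?_ ?_ ?_
  · intro m ω
    exact mul_nonneg (epProb_nonneg R H K bonus xinit ω hP0 m) (Real.exp_pos _).le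
  · intro m m' h ω τ
    rw [epProb_update_of_lt P R H K bonus xinit ω m m' h τ, hw ω m' τ _ (Fin.le_def.1 h.le),
      epKernel_update P R H K bonus ω m' τ _ (Fin.le_def.1 h.le), Function.update_of_ne h.ne]
  · intro m ω
    simp_rw [epProb_update_self, hw ω m _ _ le_rfl, epKernel_update P R H K bonus ω m _ _ le_rfl,
      Function.update_self]
    exact sum_path_exp_le_one (q := epKernel P R H K bonus ω m.val)
      (fun j x y => hP0 _ _ _) (fun j x => hP1 _ _) H _
      (hw0 ω m.val) (hw1 ω m.val)

end Interaction

section Inequalities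

lemma log_one_add_ge {y : ℝ} (hy : -(1 / 2) ≤ y) :
    y - y ^ 2 / 2 + y ^ 3 / 3 - y ^ 4 / 2 ≤ Real.log (1 + y) := by
  set g : ℝ → ℝ := fun y => Real.log (1 + y) - (y - y ^ 2 / 2 + y ^ 3 / 3 - y ^ 4 / 2) with hg
  have hd : ∀ t : ℝ, -(1 / 2) ≤ t → HasDerivAt g (t ^ 3 * (1 + 2 * t) / (1 + t)) t := by
    intro t ht
    have h1 : (1 : ℝ) + t ≠ 0 := by linarith
    have ha : HasDerivAt (fun y : ℝ => Real.log (1 + y)) (1 / (1 + t)) t :=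
      ((hasDerivAt_id t).const_add 1).log h1
    have hb : HasDerivAt (fun y : ℝ => y - y ^ 2 / 2 + y ^ 3 / 3 - y ^ 4 / 2)
        (1 - t + t ^ 2 - 2 * t ^ 3) t := by
      have := (((hasDerivAt_id t).sub ((hasDerivAt_pow 2 t).div_const 2)).add
        ((hasDerivAt_pow 3 t).div_const 3)).sub ((hasDerivAt_pow 4 t).div_const 2)
      refine this.congr_deriv ?_
      norm_num
      ring
    refine (ha.sub hb).congr_deriv ?_
    field_simp
    ring
  have h0 : g 0 = 0 := by simp [hg]
  suffices 0 ≤ g y by simp only [hg] at this; linarith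
  rcases le_total 0 y with h | h
  · have : MonotoneOn g (Set.Ici 0) := by
      refine monotoneOn_of_deriv_nonneg (convex_Ici 0)
        (fun t ht => (hd t (by linarith [Set.mem_Ici.1 ht])).continuousAt.continuousWithinAt)
        (fun t ht => ?_) (fun t ht => ?_)
      · rw [interior_Ici] at ht
        exact (hd t (by linarith [Set.mem_Ioi.1 ht])).differentiableAt.differentiableWithinAt
      · rw [interior_Ici] at ht
        have ht := Set.mem_Ioi.1 ht
        rw [(hd t (by linarith)).deriv]
        positivity
    rw [← h0]
    exact this (Set.mem_Ici.2 le_rfl) h h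
  · have : AntitoneOn g (Set.Icc (-(1 / 2)) 0) := by
      refine antitoneOn_of_deriv_nonpos (convex_Icc _ _)
        (fun t ht => (hd t ht.1).continuousAt.continuousWithinAt)
        (fun t ht => ?_) (fun t ht => ?_)
      · rw [interior_Icc] at ht
        exact (hd t ht.1.le).differentiableAt.differentiableWithinAt
      · rw [interior_Icc] at ht
        rw [(hd t ht.1.le).deriv]
        refine div_nonpos_of_nonpos_of_nonneg ?_ (by linarith [ht.1])
        have h3 : t ^ 3 ≤ 0 := by
          have : t ^ 3 = t * t ^ 2 := by ring
          rw [this]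
          exact mul_nonpos_of_nonpos_of_nonneg ht.2.le (sq_nonneg t)
        exact mul_nonpos_of_nonpos_of_nonneg h3 (by linarith [ht.1])
    rw [← h0]
    exact this ⟨hy, h⟩ ⟨by norm_num, le_rfl⟩ h

lemma exp_sub_sq_le {y u : ℝ} (hu : u ≤ 1 / 2) (hy : |y| ≤ u) :
    Real.exp (y - (1 / 2 + 7 / 12 * u) * y ^ 2) ≤ 1 + y := by
  have hy2 := abs_le.1 hy
  have hpos : 0 < 1 + y := by linarith
  rw [← Real.le_log_iff_exp_le hpos]
  refine le_trans ?_ (log_one_add_ge (by linarith))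
  have hu0 : 0 ≤ u := (abs_nonneg y).trans hy
  have h3 : 0 ≤ y ^ 2 * (y + u) := mul_nonneg (sq_nonneg y) (by linarith)
  have h4 : 0 ≤ y ^ 2 * (u * u - y * y) := by
    refine mul_nonneg (sq_nonneg y) ?_
    nlinarith
  have h5 : 0 ≤ y ^ 2 * (u * (1 / 2 - u)) :=
    mul_nonneg (sq_nonneg y) (mul_nonneg hu0 (by linarith))
  nlinarith

variable {S : Type*} [Fintype S]

/-- Variance of `f` under the weights `p`. -/
noncomputable def wvar (p f : S → ℝ) : ℝ := ∑ y, p y * f y ^ 2 - (∑ y, p y * f y) ^ 2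

lemma sum_mul_sub_sq {p : S → ℝ} (hp1 : ∑ y, p y = 1) (f : S → ℝ) (m : ℝ) :
    ∑ y, p y * (f y - m) ^ 2 = wvar p f + (∑ y, p y * f y - m) ^ 2 := by
  have : ∀ y, p y * (f y - m) ^ 2 = p y * f y ^ 2 - 2 * m * (p y * f y) + m ^ 2 * p y := by
    intro y; ring
  simp_rw [this, Finset.sum_add_distrib, Finset.sum_sub_distrib, ← Finset.mul_sum, hp1, wvar]
  ring

lemma wvar_le_sum {p : S → ℝ} (hp1 : ∑ y, p y = 1) (f : S → ℝ) (m : ℝ) :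
    wvar p f ≤ ∑ y, p y * (f y - m) ^ 2 := by
  rw [sum_mul_sub_sq hp1]
  nlinarith [sq_nonneg (∑ y, p y * f y - m)]

lemma wvar_eq_sum {p : S → ℝ} (hp1 : ∑ y, p y = 1) (f : S → ℝ) :
    wvar p f = ∑ y, p y * (f y - ∑ z, p z * f z) ^ 2 := by
  rw [sum_mul_sub_sq hp1]
  simp

lemma wvar_nonneg {p : S → ℝ} (hp0 : ∀ y, 0 ≤ p y) (hp1 : ∑ y, p y = 1) (f : S → ℝ) :
    0 ≤ wvar p f := by
  rw [wvar_eq_sum hp1]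
  exact Finset.sum_nonneg fun y _ => mul_nonneg (hp0 y) (sq_nonneg _)

/-- If `|f - g|` is dominated by `d ∈ [0,h]`, the variances of `f` and `g` compare up to `d`. -/
lemma wvar_le_of_abs_sub_le {p f g d : S → ℝ} (hp0 : ∀ y, 0 ≤ p y) (hp1 : ∑ y, p y = 1)
    {c₁ c₂ h : ℝ} (hc₂ : 0 ≤ c₂) (hc : ∀ a b : ℝ, (a + b) ^ 2 ≤ c₁ * a ^ 2 + c₂ * b ^ 2)
    (hd : ∀ y, |f y - g y| ≤ d y) (hdh : ∀ y, d y ≤ h) :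
    wvar p f ≤ c₁ * wvar p g + c₂ * (h * ∑ y, p y * d y) := by
  have h1 : wvar p (fun y => f y - g y) ≤ h * ∑ y, p y * d y := by
    refine (wvar_le_sum hp1 _ 0).trans ?_
    rw [Finset.mul_sum]
    refine Finset.sum_le_sum fun y _ => ?_
    have hd0 : 0 ≤ d y := (abs_nonneg _).trans (hd y)
    have h2 : (f y - g y - 0) ^ 2 ≤ h * d y := by
      rw [sub_zero, ← sq_abs]
      have := hd y
      have := hdh y
      nlinarith [abs_nonneg (f y - g y)]
    calc p y * (f y - g y - 0) ^ 2 ≤ p y * (h * d y) := mul_le_mul_of_nonneg_left h2 (hp0 y)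
      _ = _ := by ring
  have h2 : wvar p f ≤ c₁ * wvar p g + c₂ * wvar p (fun y => f y - g y) := by
    rw [wvar_eq_sum hp1 f, wvar_eq_sum hp1 g, wvar_eq_sum hp1 (fun y => f y - g y),
      Finset.mul_sum, Finset.mul_sum, ← Finset.sum_add_distrib]
    refine Finset.sum_le_sum fun y _ => ?_
    have h3 := hc (g y - ∑ z, p z * g z) (f y - g y - ∑ z, p z * (f z - g z))
    have h4 : ∑ z, p z * (f z - g z) = ∑ z, p z * f z - ∑ z, p z * g z := by
      rw [← Finset.sum_sub_distrib]
      exact Finset.sum_congr rfl fun z _ => by ring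
    have h5 : g y - ∑ z, p z * g z + (f y - g y - ∑ z, p z * (f z - g z))
        = f y - ∑ z, p z * f z := by rw [h4]; ring
    rw [h5] at h3
    have := mul_le_mul_of_nonneg_left h3 (hp0 y)
    linarith
  have := mul_le_mul_of_nonneg_left h1 hc₂
  linarith

/-- Self-normalized exponential moment bound. -/
lemma sum_exp_selfNormalized_le {p f : S → ℝ} (hp0 : ∀ y, 0 ≤ p y) (hp1 : ∑ y, p y = 1)
    {h lam : ℝ} (hf0 : ∀ y, 0 ≤ f y) (hf1 : ∀ y, f y ≤ h) (hl0 : 0 ≤ lam)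
    (hl1 : lam * h ≤ 1 / 2) :
    ∑ y, p y * Real.exp (lam * (∑ z, p z * f z - f y)
      - (1 / 2 + 7 / 12 * (lam * h)) * lam ^ 2 * (∑ z, p z * f z - f y) ^ 2) ≤ 1 := by
  set m := ∑ z, p z * f z with hm
  have hm0 : 0 ≤ m := Finset.sum_nonneg fun y _ => mul_nonneg (hp0 y) (hf0 y)
  have hm1 : m ≤ h := by
    calc m ≤ ∑ z, p z * h := Finset.sum_le_sum fun y _ => mul_le_mul_of_nonneg_left (hf1 y) (hp0 y)
      _ = h := by rw [← Finset.sum_mul, hp1, one_mul]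
  have key : ∀ y, p y * Real.exp (lam * (m - f y)
      - (1 / 2 + 7 / 12 * (lam * h)) * lam ^ 2 * (m - f y) ^ 2)
      ≤ p y * (1 + lam * (m - f y)) := by
    intro y
    refine mul_le_mul_of_nonneg_left ?_ (hp0 y)
    have h1 : |lam * (m - f y)| ≤ lam * h := by
      rw [abs_mul, abs_of_nonneg hl0]
      refine mul_le_mul_of_nonneg_left ?_ hl0
      rw [abs_le]
      constructor <;> linarith [hf0 y, hf1 y]
    have := exp_sub_sq_le hl1 h1
    rw [mul_pow, ← mul_assoc] at this
    exact this
  refine (Finset.sum_le_sum fun y _ => key y).trans ?_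
  have : ∀ y, p y * (1 + lam * (m - f y)) = (1 + lam * m) * p y - lam * (p y * f y) := by
    intro y; ring
  simp_rw [this, Finset.sum_sub_distrib, ← Finset.mul_sum, hp1, ← hm]
  linarith

/-- Bernstein-type exponential moment bound. -/
lemma sum_exp_bernstein_le {p f : S → ℝ} (hp0 : ∀ y, 0 ≤ p y) (hp1 : ∑ y, p y = 1)
    {h lam : ℝ} (hf0 : ∀ y, 0 ≤ f y) (hf1 : ∀ y, f y ≤ h) (hl0 : 0 ≤ lam)
    (hl1 : lam * h ≤ 1) :
    ∑ y, p y * Real.exp (lam * (f y - ∑ z, p z * f z) - lam ^ 2 * wvar p f) ≤ 1 := by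
  set m := ∑ z, p z * f z with hm
  have hm0 : 0 ≤ m := Finset.sum_nonneg fun y _ => mul_nonneg (hp0 y) (hf0 y)
  have hm1 : m ≤ h := by
    calc m ≤ ∑ z, p z * h := Finset.sum_le_sum fun y _ => mul_le_mul_of_nonneg_left (hf1 y) (hp0 y)
      _ = h := by rw [← Finset.sum_mul, hp1, one_mul]
  have key : ∀ y, p y * Real.exp (lam * (f y - m) - lam ^ 2 * wvar p f)
      ≤ Real.exp (-(lam ^ 2 * wvar p f)) * (p y + lam * (p y * f y) - lam * m * p y
        + lam ^ 2 * (p y * (f y - m) ^ 2)) := by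
    intro y
    have h1 : |lam * (f y - m)| ≤ 1 := by
      rw [abs_mul, abs_of_nonneg hl0]
      refine (mul_le_mul_of_nonneg_left ?_ hl0).trans hl1
      rw [abs_le]
      constructor <;> linarith [hf0 y, hf1 y]
    have h2 := (abs_le.1 (Real.abs_exp_sub_one_sub_id_le h1)).2
    have h3 : Real.exp (lam * (f y - m)) ≤ 1 + lam * (f y - m) + (lam * (f y - m)) ^ 2 := by
      linarith
    rw [sub_eq_add_neg, Real.exp_add]
    have h4 := mul_le_mul_of_nonneg_left h3
      (mul_nonneg (hp0 y) (Real.exp_pos (-(lam ^ 2 * wvar p f))).le)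
    linarith
  refine (Finset.sum_le_sum fun y _ => key y).trans ?_
  rw [← Finset.mul_sum]
  simp_rw [Finset.sum_add_distrib, Finset.sum_sub_distrib, Finset.sum_add_distrib,
    ← Finset.mul_sum, hp1, ← hm]
  rw [hm, ← wvar_eq_sum hp1]
  have h5 := Real.add_one_le_exp (lam ^ 2 * wvar p f)
  calc _ = Real.exp (-(lam ^ 2 * wvar p f)) * (lam ^ 2 * wvar p f + 1) := by ring
    _ ≤ Real.exp (-(lam ^ 2 * wvar p f)) * Real.exp (lam ^ 2 * wvar p f) :=
        mul_le_mul_of_nonneg_left h5 (Real.exp_pos _).le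
    _ = 1 := by rw [← Real.exp_add]; simp

/-- Exponential moment bound for the empirical frequency of a single state. -/
lemma sum_exp_indicator_le [DecidableEq S] {p : S → ℝ} (hp0 : ∀ y, 0 ≤ p y)
    (hp1 : ∑ y, p y = 1) {lam : ℝ} (hl0 : 0 ≤ lam) (hl1 : lam ≤ 1) (y : S) :
    ∑ y', p y' * Real.exp (lam * (if y' = y then 1 else 0) - (lam + lam ^ 2) * p y) ≤ 1 := by
  have h3 : Real.exp lam ≤ 1 + lam + lam ^ 2 := by
    have h2 := (abs_le.1 (Real.abs_exp_sub_one_sub_id_le (x := lam)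
      (by rw [abs_of_nonneg hl0]; exact hl1))).2
    linarith
  have key : ∀ y', p y' * Real.exp (lam * (if y' = y then 1 else 0) - (lam + lam ^ 2) * p y)
      ≤ Real.exp (-((lam + lam ^ 2) * p y))
        * (p y' + (lam + lam ^ 2) * (p y' * if y' = y then 1 else 0)) := by
    intro y'
    rw [sub_eq_add_neg, Real.exp_add]
    have h0 := mul_nonneg (hp0 y') (Real.exp_pos (-((lam + lam ^ 2) * p y))).le
    split_ifs with h
    · have := mul_le_mul_of_nonneg_left h3 h0
      rw [mul_one]
      linarith
    · simp
      linarith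
  refine (Finset.sum_le_sum fun y' _ => key y').trans ?_
  rw [← Finset.mul_sum, Finset.sum_add_distrib, ← Finset.mul_sum, hp1]
  have h5 := Real.add_one_le_exp ((lam + lam ^ 2) * p y)
  calc _ = Real.exp (-((lam + lam ^ 2) * p y)) * ((lam + lam ^ 2) * p y + 1) := by
        simp; ring
    _ ≤ Real.exp (-((lam + lam ^ 2) * p y)) * Real.exp ((lam + lam ^ 2) * p y) :=
        mul_le_mul_of_nonneg_left h5 (Real.exp_pos _).le
    _ = 1 := by rw [← Real.exp_add]; simp

lemma optimism_poly_var {u z : ℝ} (hu0 : 0 ≤ u) (hu : u ≤ 1 / 2) (hz0 : 1 / 4 ≤ z)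
    (hz1 : z ≤ 1 / 2) (hw : 0 ≤ 1 - 14 / 3 * (u * z)) :
    (1 / 2 + 7 / 12 * u) * (5 / 16 * (1 - 14 / 3 * (u * z)) ^ 2 + u * z) + 5 / 4 * z ^ 2 < z := by
  rcases le_total u (3 / 7) with h | h
  · have e1 : (1 / 2 + 7 / 12 * u) * (5 / 16 * (1 - 7 / 6 * u) ^ 2 + u / 4) + 5 / 64 < 1 / 4 := by
      nlinarith [mul_nonneg hu0 (sub_nonneg.2 h), mul_nonneg hu0 (mul_nonneg hu0 (sub_nonneg.2 h))]
    have e2 : (1 / 2 + 7 / 12 * u) * (5 / 16 * (1 - 7 / 3 * u) ^ 2 + u / 2) + 5 / 16 < 1 / 2 := by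
      nlinarith [mul_nonneg hu0 (sub_nonneg.2 h), mul_nonneg hu0 (mul_nonneg hu0 (sub_nonneg.2 h)),
        mul_nonneg hu0 (sq_nonneg (u - 1 / 4))]
    have e3 : 0 ≤ (z - 1 / 4) * (1 / 2 - z) := mul_nonneg (by linarith) (by linarith)
    have e4 : 0 ≤ ((1 / 2 + 7 / 12 * u) * (5 / 16 * (14 / 3 * u) ^ 2) + 5 / 4)
        * ((z - 1 / 4) * (1 / 2 - z)) := by positivity
    rcases eq_or_lt_of_le hz0 with h0 | h0
    · subst h0; linarith
    · nlinarith [mul_le_mul_of_nonneg_left e1.le (by linarith : 0 ≤ 2 - 4 * z),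
        mul_lt_mul_of_pos_left e2 (by linarith : 0 < 4 * z - 1)]
  · have hw2 : (1 - 14 / 3 * (u * z)) ^ 2 ≤ (1 - 2 * z) ^ 2 := by
      refine pow_le_pow_left₀ hw ?_ 2
      nlinarith
    have huz : 0 ≤ u * z := mul_nonneg hu0 (by linarith)
    have hc : (1 / 2 + 7 / 12 * u) * (5 / 16 * (1 - 14 / 3 * (u * z)) ^ 2 + u * z)
        ≤ 19 / 24 * (5 / 16 * (1 - 2 * z) ^ 2 + u * z) :=
      mul_le_mul (by linarith) (by linarith) (by positivity) (by norm_num)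
    rcases le_total z (3 / 7) with h' | h'
    · have : u * z ≤ z / 2 := by nlinarith
      nlinarith [mul_nonneg (sub_nonneg.2 hz0) (sub_nonneg.2 h')]
    · nlinarith [mul_nonneg (sub_nonneg.2 h') (sub_nonneg.2 hz1)]

lemma optimism_poly_gap {u z : ℝ} (hu0 : 0 ≤ u) (hu : u ≤ 1 / 2) (hz0 : 1 / 4 ≤ z)
    (hz1 : z ≤ 1 / 2) :
    (1 / 2 + 7 / 12 * u) * u * (5 / 3 * (1 - 14 / 3 * (u * z)) + 1) + 5 / 4 * z < 1 := by
  have e1 : (1 / 2 + 7 / 12 * u) * u * (8 / 3 - 35 / 18 * u) + 5 / 16 < 1 := by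
    nlinarith [mul_nonneg hu0 (sub_nonneg.2 hu), mul_nonneg hu0 (mul_nonneg hu0 (sub_nonneg.2 hu))]
  have e2 : (1 / 2 + 7 / 12 * u) * u * (8 / 3 - 35 / 9 * u) + 5 / 8 < 1 := by
    nlinarith [mul_nonneg hu0 (sub_nonneg.2 hu), mul_nonneg hu0 (sq_nonneg (u - 2 / 5)),
      sq_nonneg (u - 2 / 5)]
  nlinarith [mul_le_mul_of_nonneg_left e1.le (by linarith : 0 ≤ 2 - 4 * z),
    mul_le_mul_of_nonneg_left e2.le (by linarith : 0 ≤ 4 * z - 1)]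

lemma optimism_poly {u z α β : ℝ} (hu0 : 0 ≤ u) (hu : u ≤ 1 / 2) (hz0 : 1 / 4 ≤ z)
    (hz1 : z ≤ 1 / 2) (hα : 0 ≤ α) (hβ : 0 ≤ β) (hs : α + β + 14 / 3 * (u * z) ≤ 1) :
    (1 / 2 + 7 / 12 * u) * (5 / 16 * β ^ 2 + 5 / 3 * (u * z) * α + u * z) + 5 / 4 * z ^ 2 < z := by
  set w := 1 - 14 / 3 * (u * z) with hw
  have hw0 : 0 ≤ w := by linarith
  have hc : 0 ≤ 1 / 2 + 7 / 12 * u := by linarith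
  have huz : 0 ≤ u * z := mul_nonneg hu0 (by linarith)
  have hβw : β ^ 2 ≤ β * w := by nlinarith
  rcases le_total (5 / 3 * (u * z)) (5 / 16 * w) with h | h
  · have h1 : 5 / 16 * β ^ 2 + 5 / 3 * (u * z) * α ≤ 5 / 16 * w ^ 2 := by nlinarith
    have h2 := optimism_poly_var hu0 hu hz0 hz1 hw0
    rw [← hw] at h2
    nlinarith [mul_le_mul_of_nonneg_left h1 hc]
  · have h1 : 5 / 16 * β ^ 2 + 5 / 3 * (u * z) * α ≤ 5 / 3 * (u * z) * w := by nlinarith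
    have h2 := mul_lt_mul_of_pos_left (optimism_poly_gap hu0 hu hz0 hz1)
      (by linarith : (0 : ℝ) < z)
    rw [← hw] at h2
    nlinarith [mul_le_mul_of_nonneg_left h1 hc]

lemma bernstein_scale_contra {a b h r W V Δ lam : ℝ} (ha0 : 0 ≤ a) (hb0 : 0 ≤ b)
    (hb2 : b ^ 2 = 8 * r * W) (hh : 0 < h) (hr : 0 < r) (hlam0 : 0 < lam)
    (hΔ1 : a + b + 14 / 3 * (h * r) < Δ) (hΔh : Δ ≤ h) (hu2 : lam * h ≤ 1 / 2)
    (hD1 : 2 * r ≤ lam * Δ) (hD2 : lam * Δ ≤ 4 * r) (hvar : V ≤ 5 / 2 * W + 5 / 3 * (h * a)) :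
    5 / 4 * r < lam * Δ - (1 / 2 + 7 / 12 * (lam * h)) * lam ^ 2 * (V + Δ ^ 2) := by
  by_contra hE
  push Not at hE
  have hhr : 0 < h * r := mul_pos hh hr
  have hΔ0 : 0 < Δ := by linarith
  have hD0 : 0 < lam * Δ := mul_pos hlam0 hΔ0
  have hz0 : 1 / 4 ≤ r / (lam * Δ) := by rw [le_div_iff₀ hD0]; linarith
  have hz1 : r / (lam * Δ) ≤ 1 / 2 := by rw [div_le_iff₀ hD0]; linarith
  have hsum : a / Δ + b / Δ + 14 / 3 * (lam * h * (r / (lam * Δ))) ≤ 1 := by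
    have : a / Δ + b / Δ + 14 / 3 * (lam * h * (r / (lam * Δ)))
        = (a + b + 14 / 3 * (h * r)) / Δ := by field_simp
    rw [this, div_le_one hΔ0]
    exact hΔ1.le
  have hpoly := optimism_poly (by positivity : 0 ≤ lam * h) hu2 hz0 hz1 (α := a / Δ) (β := b / Δ)
    (by positivity) (by positivity) hsum
  have hc : 0 ≤ (1 / 2 + 7 / 12 * (lam * h)) * lam ^ 2 := by positivity
  have hΔ2 : Δ ^ 2 ≤ h * Δ := by nlinarith
  have hE2 : lam * Δ ≤ (1 / 2 + 7 / 12 * (lam * h)) * lam ^ 2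
      * (5 / 2 * W + 5 / 3 * (h * a) + h * Δ) + 5 / 4 * r := by
    have := mul_le_mul_of_nonneg_left (add_le_add hvar hΔ2) hc
    linarith
  have hE3 := mul_le_mul_of_nonneg_right hE2 (by positivity : 0 ≤ r / (lam * Δ) ^ 2)
  have e1 : lam * Δ * (r / (lam * Δ) ^ 2) = r / (lam * Δ) := by field_simp
  have e2 : ((1 / 2 + 7 / 12 * (lam * h)) * lam ^ 2
      * (5 / 2 * W + 5 / 3 * (h * a) + h * Δ) + 5 / 4 * r) * (r / (lam * Δ) ^ 2)
      = (1 / 2 + 7 / 12 * (lam * h)) * (5 / 16 * (b / Δ) ^ 2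
        + 5 / 3 * (lam * h * (r / (lam * Δ))) * (a / Δ)
        + lam * h * (r / (lam * Δ))) + 5 / 4 * (r / (lam * Δ)) ^ 2 := by
    rw [div_pow b, hb2]
    field_simp
    ring
  rw [e1, e2] at hE3
  linarith

/-- Empirical Bernstein optimism: self-normalized deviation control of `f` at dyadic scales bounds
`m` by the empirical mean of any `g ≥ f` plus a bonus built from the empirical variance of `g`. -/
lemma le_sum_add_bernstein {p f g : S → ℝ} (hp0 : ∀ y, 0 ≤ p y) (hp1 : ∑ y, p y = 1)
    {h r m : ℝ} (hh : 0 < h) (hr : 0 < r) (hf0 : ∀ y, 0 ≤ f y) (hfg : ∀ y, f y ≤ g y)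
    (hg : ∀ y, g y ≤ h) (hm : m ≤ h)
    (hev : ∀ i : ℕ, (2 : ℝ) ^ i * (4 * r) ≤ 1 → ∀ lam : ℝ, lam = 1 / (2 * h * 2 ^ i) →
      ∑ y, p y * (lam * (m - f y) - (1 / 2 + 7 / 12 * (lam * h)) * lam ^ 2 * (m - f y) ^ 2)
        ≤ 5 / 4 * r) :
    m ≤ ∑ y, p y * g y + √(8 * r * wvar p g) + 14 / 3 * h * r := by
  by_contra hcon
  push Not at hcon
  set a := ∑ y, p y * (g y - f y) with ha
  have ha0 : 0 ≤ a := Finset.sum_nonneg fun y _ => mul_nonneg (hp0 y) (by linarith [hfg y])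
  have hga : ∑ y, p y * g y = ∑ y, p y * f y + a := by
    rw [ha, ← Finset.sum_add_distrib]
    exact Finset.sum_congr rfl fun y _ => by ring
  set F := ∑ y, p y * f y with hF
  have hF0 : 0 ≤ F := Finset.sum_nonneg fun y _ => mul_nonneg (hp0 y) (hf0 y)
  have hW := wvar_nonneg hp0 hp1 g
  set b := √(8 * r * wvar p g) with hb
  have hb0 : 0 ≤ b := Real.sqrt_nonneg _
  have hb2 : b ^ 2 = 8 * r * wvar p g := Real.sq_sqrt (by positivity)
  set Δ := m - F with hΔ
  have hhr : 0 < h * r := mul_pos hh hr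
  have hΔ1 : a + b + 14 / 3 * (h * r) < Δ := by rw [hga] at hcon; linarith
  have hΔh : Δ ≤ h := by linarith
  obtain ⟨i, hi1, hi2⟩ := exists_nat_pow_near (x := Δ / (4 * (h * r))) (y := (2 : ℝ))
    (by rw [le_div_iff₀ (by positivity)]; linarith) (by norm_num)
  rw [le_div_iff₀ (by positivity)] at hi1
  rw [div_lt_iff₀ (by positivity), pow_succ] at hi2
  have h2i : (1 : ℝ) ≤ 2 ^ i := one_le_pow₀ (by norm_num)
  have hirr : (2 : ℝ) ^ i * (4 * r) ≤ 1 := by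
    have : ((2 : ℝ) ^ i * (4 * r)) * h ≤ 1 * h := by linarith
    exact le_of_mul_le_mul_right this hh
  set lam : ℝ := 1 / (2 * h * 2 ^ i) with hlam
  have hlam0 : 0 < lam := by positivity
  have hli : lam * (2 * h * 2 ^ i) = 1 := by rw [hlam]; field_simp
  have hE := hev i hirr lam rfl
  set u := lam * h with hu
  have hu0 : 0 ≤ u := by positivity
  have hu2 : u ≤ 1 / 2 := by
    have : u * 2 * 1 ≤ u * 2 * 2 ^ i := mul_le_mul_of_nonneg_left h2i (by positivity)
    have h3 : u * 2 * 2 ^ i = 1 := by rw [hu]; linarith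
    linarith
  set D := lam * Δ with hD
  have hΔ0 : 0 < Δ := by nlinarith
  have hD0 : 0 < D := mul_pos hlam0 hΔ0
  have hD1 : 2 * r ≤ D := by
    have := mul_le_mul_of_nonneg_left hi1 hlam0.le
    calc 2 * r = 2 * r * (lam * (2 * h * 2 ^ i)) := by rw [hli, mul_one]
      _ = lam * (2 ^ i * (4 * (h * r))) := by ring
      _ ≤ D := this
  have hD2 : D ≤ 4 * r := by
    have := mul_le_mul_of_nonneg_left hi2.le hlam0.le
    calc D ≤ lam * (2 ^ i * 2 * (4 * (h * r))) := this
      _ = 4 * r * (lam * (2 * h * 2 ^ i)) := by ring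
      _ = 4 * r := by rw [hli, mul_one]
  have hexp : ∑ y, p y * (lam * (m - f y) - (1 / 2 + 7 / 12 * u) * lam ^ 2 * (m - f y) ^ 2)
      = D - (1 / 2 + 7 / 12 * u) * lam ^ 2 * (wvar p f + Δ ^ 2) := by
    have h1 := sum_mul_sub_sq hp1 f m
    have h2 : ∀ y, p y * (lam * (m - f y) - (1 / 2 + 7 / 12 * u) * lam ^ 2 * (m - f y) ^ 2)
        = lam * m * p y - lam * (p y * f y)
          - (1 / 2 + 7 / 12 * u) * lam ^ 2 * (p y * (f y - m) ^ 2) := by intro y; ring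
    simp_rw [h2, Finset.sum_sub_distrib, ← Finset.mul_sum, h1, hp1, ← hF, hD, hΔ]
    ring
  rw [hexp] at hE
  have hvar : wvar p f ≤ 5 / 2 * wvar p g + 5 / 3 * (h * a) := by
    refine wvar_le_of_abs_sub_le hp0 hp1 (by norm_num) ?_ ?_ ?_
    · intro a b
      nlinarith [sq_nonneg (3 * a - 2 * b)]
    · intro y
      rw [abs_sub_comm, abs_of_nonneg (by linarith [hfg y])]
    · intro y
      linarith [hf0 y, hg y]
  exact absurd hE (not_le.2 (bernstein_scale_contra ha0 hb0 hb2 hh hr hlam0 hΔ1 hΔh hu2 hD1 hD2 hvar))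

end Inequalities

section Values

set_option linter.unusedSectionVars false

variable {S A : Type*} [Fintype S] [Fintype A]
  [Nonempty A]

lemma le_maxA (f : A → ℝ) (a : A) : f a ≤ maxA f := Finset.le_sup' f (Finset.mem_univ a)

lemma maxA_le {f : A → ℝ} {c : ℝ} (h : ∀ a, f a ≤ c) : maxA f ≤ c :=
  Finset.sup'_le _ _ fun a _ => h a

lemma maxA_eq_argmaxA (f : A → ℝ) : maxA f = f (argmaxA f) := by
  have hspec := (Finset.exists_max_image Finset.univ f
    ⟨Classical.arbitrary A, Finset.mem_univ _⟩).choose_spec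
  exact le_antisymm (maxA_le fun a => hspec.2 a (Finset.mem_univ a)) (le_maxA f _)

lemma weighted_sum_le {p f : S → ℝ} (hp0 : ∀ y, 0 ≤ p y) (hp1 : ∑ y, p y = 1) {c : ℝ}
    (hf : ∀ y, f y ≤ c) : ∑ y, p y * f y ≤ c := by
  calc ∑ y, p y * f y ≤ ∑ y, p y * c :=
        Finset.sum_le_sum fun y _ => mul_le_mul_of_nonneg_left (hf y) (hp0 y)
    _ = c := by rw [← Finset.sum_mul, hp1, one_mul]

variable {P : S → A → S → ℝ} {R : S → A → ℝ}

lemma VstarJ_nonneg (hP0 : ∀ x a y, 0 ≤ P x a y) (hR0 : ∀ x a, 0 ≤ R x a) (j : ℕ) (x : S) :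
    0 ≤ VstarJ P R j x := by
  induction j generalizing x with
  | zero => exact le_rfl
  | succ j ih =>
    exact (add_nonneg (hR0 x (Classical.arbitrary A))
      (Finset.sum_nonneg fun y _ => mul_nonneg (hP0 _ _ _) (ih y))).trans
      (le_maxA (fun a => R x a + ∑ y, P x a y * VstarJ P R j y) (Classical.arbitrary A))

lemma VstarJ_le (hP0 : ∀ x a y, 0 ≤ P x a y) (hP1 : ∀ x a, ∑ y, P x a y = 1)
    (hR1 : ∀ x a, R x a ≤ 1) (j : ℕ) (x : S) : VstarJ P R j x ≤ j := by
  induction j generalizing x with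
  | zero => simp [VstarJ]
  | succ j ih =>
    refine maxA_le fun a => ?_
    have := weighted_sum_le (hP0 x a) (hP1 x a) ih
    push_cast
    linarith [hR1 x a]

lemma VpolJ_nonneg (hP0 : ∀ x a y, 0 ≤ P x a y) (hR0 : ∀ x a, 0 ≤ R x a) (π : ℕ → S → A)
    (j : ℕ) (x : S) : 0 ≤ VpolJ P R π j x := by
  induction j generalizing x with
  | zero => exact le_rfl
  | succ j ih =>
    exact add_nonneg (hR0 _ _) (Finset.sum_nonneg fun y _ => mul_nonneg (hP0 _ _ _) (ih y))

lemma VpolJ_le_VstarJ (hP0 : ∀ x a y, 0 ≤ P x a y) (π : ℕ → S → A)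
    (j : ℕ) (x : S) : VpolJ P R π j x ≤ VstarJ P R j x := by
  induction j generalizing x with
  | zero => exact le_rfl
  | succ j ih =>
    refine le_trans ?_ (le_maxA (fun a => R x a + ∑ y, P x a y * VstarJ P R j y) (π (j + 1) x))
    exact add_le_add le_rfl
      (Finset.sum_le_sum fun y _ => mul_le_mul_of_nonneg_left (ih y) (hP0 _ _ _))

lemma expSum_nonneg {q w : ℕ → S → S → ℝ} (hq : ∀ j x y, 0 ≤ q j x y) (hw : ∀ j x y, 0 ≤ w j x y)
    (j : ℕ) (x : S) : 0 ≤ expSum q w j x := by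
  induction j generalizing x with
  | zero => exact le_rfl
  | succ j ih =>
    exact Finset.sum_nonneg fun y _ => mul_nonneg (hq _ _ _) (add_nonneg (hw _ _ _) (ih y))

/-- One-step variance of the value of `π` with `j` remaining steps, as a path functional. -/
noncomputable def stepVar (P : S → A → S → ℝ) (R : S → A → ℝ) (π : ℕ → S → A)
    (j : ℕ) (x _y : S) : ℝ := wvar (P x (π j x)) (VpolJ P R π (j - 1))

lemma expSum_stepVar_succ (hP1 : ∀ x a, ∑ y, P x a y = 1) (π : ℕ → S → A) (j : ℕ) (x : S) :
    expSum (fun j x y => P x (π j x) y) (stepVar P R π) (j + 1) x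
      = wvar (P x (π (j + 1) x)) (VpolJ P R π j)
        + ∑ y, P x (π (j + 1) x) y * expSum (fun j x y => P x (π j x) y) (stepVar P R π) j y := by
  simp only [expSum, stepVar, mul_add, Finset.sum_add_distrib, ← Finset.sum_mul, hP1, one_mul,
    Nat.add_sub_cancel]

/-- Law of total variance bound for the accumulated one-step variances. -/
lemma expSum_stepVar_add_sq_le (hP0 : ∀ x a y, 0 ≤ P x a y) (hP1 : ∀ x a, ∑ y, P x a y = 1)
    (hR0 : ∀ x a, 0 ≤ R x a) (hR1 : ∀ x a, R x a ≤ 1) (π : ℕ → S → A) (j : ℕ) (x : S) :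
    expSum (fun j x y => P x (π j x) y) (stepVar P R π) j x + VpolJ P R π j x ^ 2
      ≤ j * VpolJ P R π j x := by
  induction j generalizing x with
  | zero => simp [expSum, VpolJ]
  | succ j ih =>
    rw [expSum_stepVar_succ hP1]
    set a := π (j + 1) x with ha
    have h1 : ∑ y, P x a y * expSum (fun j x y => P x (π j x) y) (stepVar P R π) j y
        ≤ j * ∑ y, P x a y * VpolJ P R π j y - ∑ y, P x a y * VpolJ P R π j y ^ 2 := by
      rw [Finset.mul_sum, ← Finset.sum_sub_distrib]
      refine Finset.sum_le_sum fun y _ => ?_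
      have := mul_le_mul_of_nonneg_left (ih y) (hP0 x a y)
      linarith
    have hV : VpolJ P R π (j + 1) x = R x a + ∑ y, P x a y * VpolJ P R π j y := rfl
    have hm0 : 0 ≤ ∑ y, P x a y * VpolJ P R π j y :=
      Finset.sum_nonneg fun y _ => mul_nonneg (hP0 _ _ _) (VpolJ_nonneg hP0 hR0 π j y)
    have hm1 : ∑ y, P x a y * VpolJ P R π j y ≤ j :=
      weighted_sum_le (hP0 x a) (hP1 x a) fun y =>
        (VpolJ_le_VstarJ hP0 π j y).trans (VstarJ_le hP0 hP1 hR1 j y)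
    rw [hV, wvar]
    generalize ∑ y, P x a y * VpolJ P R π j y = m at *
    push_cast
    nlinarith [hR0 x a, hR1 x a, mul_nonneg (hR0 x a) (sub_nonneg.2 (hR1 x a)),
      mul_nonneg (hR0 x a) (sub_nonneg.2 hm1), mul_nonneg hm0 (sub_nonneg.2 (hR1 x a))]

lemma expSum_stepVar_le (hP0 : ∀ x a y, 0 ≤ P x a y) (hP1 : ∀ x a, ∑ y, P x a y = 1)
    (hR0 : ∀ x a, 0 ≤ R x a) (hR1 : ∀ x a, R x a ≤ 1) (π : ℕ → S → A) (j : ℕ) (x : S) :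
    expSum (fun j x y => P x (π j x) y) (stepVar P R π) j x ≤ (j : ℝ) ^ 2 / 4 := by
  have := expSum_stepVar_add_sq_le hP0 hP1 hR0 hR1 π j x
  nlinarith [sq_nonneg (VpolJ P R π j x - j / 2)]

lemma sqrt_le_of_factors {a b : ℝ} (ha : 0 ≤ a) (hb : 0 ≤ b) : √(4 * (a * b)) ≤ a + b := by
  rw [Real.sqrt_le_left (by positivity)]
  nlinarith [sq_nonneg (a - b)]

lemma sum_emp_mul_le {p phat f : S → ℝ} {t c h : ℝ} (hc : 0 ≤ c)
    (hE : ∀ y, phat y ≤ (1 + t) * p y + c) (hf0 : ∀ y, 0 ≤ f y) (hf1 : ∀ y, f y ≤ h) :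
    ∑ y, phat y * f y ≤ (1 + t) * ∑ y, p y * f y + Fintype.card S * (c * h) := by
  calc ∑ y, phat y * f y ≤ ∑ y, ((1 + t) * (p y * f y) + c * h) := by
        refine Finset.sum_le_sum fun y _ => ?_
        have h1 := mul_le_mul_of_nonneg_right (hE y) (hf0 y)
        have h2 := mul_le_mul_of_nonneg_left (hf1 y) hc
        linarith
    _ = _ := by
        rw [Finset.sum_add_distrib, ← Finset.mul_sum]
        simp

/-- Coefficient of the inverse visit count in the one-step gap recursion. -/
noncomputable def invCoef (s h L Λ E : ℝ) : ℝ :=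
  4 * L * Λ + 8 * s * h ^ 2 * L + 14 * h * L / 3 + 2 * E + (1 / Λ + 1 / E) * (8 * s * h ^ 3 * L)

/-- One-step optimistic gap bound at a state-action pair with `n` visits. -/
lemma one_step_gap {p phat U f v g : S → ℝ} {h L Λ E n : ℝ}
    (hp0 : ∀ y, 0 ≤ p y) (hp1 : ∑ y, p y = 1) (hq0 : ∀ y, 0 ≤ phat y) (hq1 : ∑ y, phat y = 1)
    (hh : 1 ≤ h) (hL : 0 ≤ L) (hΛ : 18 * h ^ 2 ≤ Λ) (hE : 0 < E) (hn : 0 < n)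
    (hv0 : ∀ y, 0 ≤ v y) (hvf : ∀ y, v y ≤ f y) (hfU : ∀ y, f y ≤ U y) (hU : ∀ y, U y ≤ h)
    (hg0 : ∀ y, 0 ≤ g y) (hg1 : ∀ y, g y ≤ h ^ 2)
    (hT : 1 / Λ * (∑ y, phat y * f y - ∑ y, p y * f y) - (1 / Λ) ^ 2 * wvar p f ≤ 2 * L / n)
    (hF : ∀ y, phat y ≤ (1 + 1 / (4 * h)) * p y + 8 * h * L / n) :
    ∑ y, phat y * U y + (√(8 * L * wvar phat U / n) + 14 * h * L / (3 * n)
        + √(8 * (∑ y, phat y * g y) / n)) - ∑ y, p y * v y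
      ≤ (1 + 1 / (2 * h)) * ∑ y, p y * (U y - v y) + 4.5 / Λ * wvar p v
        + 1.25 / E * ∑ y, p y * g y + invCoef (Fintype.card S) h L Λ E / n := by
  have hh0 : 0 < h := by linarith
  have hΛ0 : 0 < Λ := lt_of_lt_of_le (by positivity) hΛ
  set s := ((Fintype.card S : ℕ) : ℝ) with hs
  set c := 8 * h * L / n with hc
  have hc0 : 0 ≤ c := by positivity
  set D := ∑ y, p y * (U y - v y) with hD
  have hD0 : 0 ≤ D := Finset.sum_nonneg fun y _ => mul_nonneg (hp0 y) (by linarith [hvf y, hfU y])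
  have ht : 1 / (4 * h) ≤ 1 / 4 := by
    rw [div_le_div_iff₀ (by positivity) (by norm_num)]; linarith
  -- decomposition of the mean difference
  have hsplit : ∑ y, phat y * U y - ∑ y, p y * v y
      = D + (∑ y, phat y * f y - ∑ y, p y * f y)
        + (∑ y, phat y * (U y - f y) - ∑ y, p y * (U y - f y)) := by
    rw [hD]
    simp only [mul_sub, Finset.sum_sub_distrib]
    ring
  have hT' : ∑ y, phat y * f y - ∑ y, p y * f y ≤ 1 / Λ * wvar p f + 2 * L * Λ / n := by
    have := mul_le_mul_of_nonneg_left hT hΛ0.le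
    have e1 : Λ * (1 / Λ * (∑ y, phat y * f y - ∑ y, p y * f y) - (1 / Λ) ^ 2 * wvar p f)
        = (∑ y, phat y * f y - ∑ y, p y * f y) - 1 / Λ * wvar p f := by field_simp
    rw [e1] at this
    have e2 : Λ * (2 * L / n) = 2 * L * Λ / n := by ring
    linarith
  have hUf : ∑ y, phat y * (U y - f y) - ∑ y, p y * (U y - f y)
      ≤ 1 / (4 * h) * D + s * (c * h) := by
    have h1 := sum_emp_mul_le (f := fun y => U y - f y) (h := h) hc0 hF
      (fun y => by linarith [hfU y]) (fun y => by linarith [hU y, hv0 y, hvf y])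
    have h2 : ∑ y, p y * (U y - f y) ≤ D :=
      Finset.sum_le_sum fun y _ => mul_le_mul_of_nonneg_left (by linarith [hvf y]) (hp0 y)
    have := mul_le_mul_of_nonneg_left h2 (by positivity : 0 ≤ 1 / (4 * h))
    linarith
  have hvarU : wvar p U ≤ 2 * wvar p v + 2 * (h * D) := by
    refine wvar_le_of_abs_sub_le hp0 hp1 (by norm_num)
      (fun a b => by nlinarith [sq_nonneg (a - b)]) ?_ ?_
    · intro y
      rw [abs_of_nonneg (by linarith [hvf y, hfU y])]
    · intro y
      linarith [hU y, hv0 y]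
  have hvarf : wvar p f ≤ 2 * wvar p v + 2 * (h * D) := by
    refine wvar_le_of_abs_sub_le hp0 hp1 (by norm_num)
      (fun a b => by nlinarith [sq_nonneg (a - b)]) ?_ ?_
    · intro y
      rw [abs_of_nonneg (by linarith [hvf y])]
      linarith [hfU y]
    · intro y
      linarith [hU y, hv0 y]
  have hW : wvar phat U ≤ 1.25 * wvar p U + s * (c * h ^ 2) := by
    have hm0 : 0 ≤ ∑ z, p z * U z :=
      Finset.sum_nonneg fun y _ => mul_nonneg (hp0 y) (by linarith [hv0 y, hvf y, hfU y])
    have hm1 : ∑ z, p z * U z ≤ h := weighted_sum_le hp0 hp1 hU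
    have h1 := sum_emp_mul_le (f := fun y => (U y - ∑ z, p z * U z) ^ 2) (h := h ^ 2) hc0 hF
      (fun y => sq_nonneg _) (fun y => by
        have : |U y - ∑ z, p z * U z| ≤ h := by
          rw [abs_le]
          constructor <;> linarith [hU y, hv0 y, hvf y, hfU y]
        rw [← sq_abs]
        exact pow_le_pow_left₀ (abs_nonneg _) this 2)
    have h2 := wvar_le_sum hq1 U (∑ z, p z * U z)
    have h3 := wvar_nonneg hp0 hp1 U
    rw [wvar_eq_sum hp1 U] at h3 ⊢
    have := mul_le_mul_of_nonneg_right (by linarith : 1 + 1 / (4 * h) ≤ 1.25) h3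
    linarith
  have hsq1 : √(8 * L * wvar phat U / n) ≤ 1 / Λ * wvar phat U + 2 * L * Λ / n := by
    have := sqrt_le_of_factors (a := 1 / Λ * wvar phat U) (b := 2 * L * Λ / n)
      (mul_nonneg (by positivity) (wvar_nonneg hq0 hq1 U)) (by positivity)
    have e : 8 * L * wvar phat U / n = 4 * (1 / Λ * wvar phat U * (2 * L * Λ / n)) := by
      field_simp
      ring
    rwa [e]
  have hG0 : 0 ≤ ∑ y, phat y * g y := Finset.sum_nonneg fun y _ => mul_nonneg (hq0 y) (hg0 y)
  have hsq2 : √(8 * (∑ y, phat y * g y) / n) ≤ 1 / E * (∑ y, phat y * g y) + 2 * E / n := by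
    have := sqrt_le_of_factors (a := 1 / E * ∑ y, phat y * g y) (b := 2 * E / n)
      (mul_nonneg (by positivity) hG0) (by positivity)
    have e : 8 * (∑ y, phat y * g y) / n = 4 * (1 / E * (∑ y, phat y * g y) * (2 * E / n)) := by
      field_simp
      ring
    rwa [e]
  have hG : ∑ y, phat y * g y ≤ 1.25 * ∑ y, p y * g y + s * (c * h ^ 2) := by
    have h1 := sum_emp_mul_le hc0 hF hg0 hg1
    have := mul_le_mul_of_nonneg_right (by linarith : 1 + 1 / (4 * h) ≤ 1.25)
      (Finset.sum_nonneg fun y (_ : y ∈ Finset.univ) => mul_nonneg (hp0 y) (hg0 y))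
    linarith
  have hG' := mul_le_mul_of_nonneg_left hG (by positivity : 0 ≤ 1 / E)
  have hWf : 1 / Λ * (wvar phat U + wvar p f)
      ≤ 1 / Λ * (4.5 * wvar p v + s * (c * h ^ 2)) + 1 / (4 * h) * D := by
    have h1 : wvar phat U + wvar p f ≤ (4.5 * wvar p v + s * (c * h ^ 2)) + 4.5 * (h * D) := by
      linarith
    have h2 := mul_le_mul_of_nonneg_left h1 (by positivity : 0 ≤ 1 / Λ)
    have h3 : 1 / Λ * (4.5 * (h * D)) ≤ 1 / (4 * h) * D := by
      have : 1 / Λ * (4.5 * h) ≤ 1 / (4 * h) := by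
        rw [div_mul_eq_mul_div, div_le_div_iff₀ hΛ0 (by positivity)]
        nlinarith
      have := mul_le_mul_of_nonneg_right this hD0
      linarith
    linarith
  have hA : invCoef s h L Λ E / n = 4 * L * Λ / n + s * (c * h) + 14 * h * L / (3 * n)
      + 2 * E / n + (1 / Λ + 1 / E) * (s * (c * h ^ 2)) := by
    rw [invCoef, hc]
    field_simp
  have hD2 : (1 + 1 / (2 * h)) * D = D + 1 / (4 * h) * D + 1 / (4 * h) * D := by
    field_simp
    ring
  have e1 : 4.5 / Λ * wvar p v = 1 / Λ * (4.5 * wvar p v) := by ring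
  have e2 : 1.25 / E * ∑ y, p y * g y = 1 / E * (1.25 * ∑ y, p y * g y) := by ring
  have e3 : 4 * L * Λ / n = 2 * L * Λ / n + 2 * L * Λ / n := by ring
  rw [hA, hD2, e1, e2, e3]
  linarith

end Values

section Algorithm

set_option linter.unusedSectionVars false

variable {S A : Type*} [Fintype S] [Fintype A] [DecidableEq S] [DecidableEq A]
  [Nonempty A]
  (P : S → A → S → ℝ) (R : S → A → ℝ) (H : ℕ) {K : ℕ}
  (bonus : (S → A → ℕ) → (S → A → S → ℝ) → (ℕ → S → ℕ) → ℕ → (S → ℝ) → S → A → ℝ)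
  (ω : Fin K → Fin (H + 1) → S)

/-- Optimistic values `V_{k,·}` of episode `k`, indexed by remaining steps. -/
noncomputable def optV (k j : ℕ) (y : S) : ℝ := maxA (fun b => Qep R H K bonus ω k j y b)

lemma Qep_zero {k : ℕ} (hk : k < K) (x : S) (a : A) : Qep R H K bonus ω k 0 x a = 0 := by
  rw [Qep_eq R H bonus ω k hk]
  rfl

lemma Qep_succ {k : ℕ} (hk : k < K) (j : ℕ) (x : S) (a : A) :
    Qep R H K bonus ω k (j + 1) x a = if visits R H K bonus ω k x a = 0 then (H : ℝ)
      else min ((epState R H K bonus ω k).2.2.2 (j + 1) x a) (min (H : ℝ)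
        (R x a + (∑ y, empP R H K bonus ω k x a y * optV R H bonus ω k j y)
          + bonus (visits R H K bonus ω k) (empP R H K bonus ω k) (posVisits R H K bonus ω k) j
            (optV R H bonus ω k j) x a)) := by
  unfold optV
  rw [Qep_eq R H bonus ω k hk]
  rfl

lemma Qep_le {k : ℕ} (hk : k < K) (j : ℕ) (x : S) (a : A) : Qep R H K bonus ω k j x a ≤ H := by
  cases j with
  | zero => rw [Qep_zero R H bonus ω hk]; positivity
  | succ j =>
    rw [Qep_succ R H bonus ω hk]
    split_ifs
    · exact le_rfl
    · exact (min_le_right _ _).trans (min_le_left _ _)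

lemma optV_zero {k : ℕ} (hk : k < K) (y : S) : optV R H bonus ω k 0 y = 0 := by
  unfold optV
  rw [maxA_eq_argmaxA, Qep_zero R H bonus ω hk]

lemma optV_le {k : ℕ} (hk : k < K) (j : ℕ) (y : S) : optV R H bonus ω k j y ≤ H :=
  maxA_le fun a => Qep_le R H bonus ω hk j y a

lemma optV_eq_polep (k j : ℕ) (x : S) :
    optV R H bonus ω k j x = Qep R H K bonus ω k j x (polep R H K bonus ω k j x) :=
  maxA_eq_argmaxA _

lemma pathSum_hitWeight_le (x : S) (a : A) (k : ℕ) (τ : Fin (H + 1) → S) :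
    pathSum (hitWeight R H K bonus ω x a (fun _ => 1) k) H τ ≤ H := by
  unfold pathSum hitWeight
  calc _ ≤ ∑ p : Fin H, (1 : ℝ) := Finset.sum_le_sum fun p _ => by split_ifs <;> norm_num
    _ = H := by simp

lemma visits_le {k : ℕ} (hk : k ≤ K) (x : S) (a : A) :
    visits R H K bonus ω k x a ≤ k * H := by
  induction k with
  | zero => simp [visits, epState]
  | succ k ih =>
    have h1 := visits_succ R H bonus ω k hk x a
    have h2 := pathSum_hitWeight_le R H bonus ω x a k (ω ⟨k, hk⟩)
    have h3 : (visits R H K bonus ω k x a : ℝ) ≤ k * H := by exact_mod_cast ih (by omega)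
    have : (visits R H K bonus ω (k + 1) x a : ℝ) ≤ ((k + 1) * H : ℕ) := by
      push_cast; linarith
    exact_mod_cast this

lemma empP_nonneg (k : ℕ) (x : S) (a : A) (y : S) : 0 ≤ empP R H K bonus ω k x a y :=
  div_nonneg (Nat.cast_nonneg _) (Nat.cast_nonneg _)

lemma sum_empP_mul (k : ℕ) (x : S) (a : A) (φ : S → ℝ) :
    ∑ y, empP R H K bonus ω k x a y * φ y
      = (∑ y, (transitions R H K bonus ω k x a y : ℝ) * φ y) / visits R H K bonus ω k x a := by
  rw [Finset.sum_div]
  exact Finset.sum_congr rfl fun y _ => by unfold empP; ring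

lemma sum_empP {k : ℕ} (hk : k ≤ K) {x : S} {a : A} (hn : visits R H K bonus ω k x a ≠ 0) :
    ∑ y, empP R H K bonus ω k x a y = 1 := by
  have h := sum_empP_mul R H bonus ω k x a (fun _ => 1)
  simp only [mul_one] at h
  rw [h, sum_transitions R H bonus ω k hk]
  exact div_self (by exact_mod_cast hn)

/-- Concentration of the observed transitions: self-normalized lower deviations at dyadic scales,
Bernstein upper deviations, and upper deviations of the empirical frequencies. -/
structure TransitionsConcentrate (L Λ : ℝ) : Prop where
  optimism : ∀ k < K, ∀ x a, ∀ j < H, ∀ i < Nat.log 2 (K * H) + 1,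
    ∑ y, (transitions R H K bonus ω k x a y : ℝ)
      * (1 / (2 * (H : ℝ) * 2 ^ i) * (∑ z, P x a z * VstarJ P R j z - VstarJ P R j y)
        - (1 / 2 + 7 / 12 * (1 / (2 * (H : ℝ) * 2 ^ i) * H)) * (1 / (2 * (H : ℝ) * 2 ^ i)) ^ 2
          * (∑ z, P x a z * VstarJ P R j z - VstarJ P R j y) ^ 2) ≤ 5 / 4 * L
  bernstein : ∀ k < K, ∀ x a, ∀ j < H,
    ∑ y, (transitions R H K bonus ω k x a y : ℝ)
      * (1 / Λ * (VstarJ P R j y - ∑ z, P x a z * VstarJ P R j z)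
        - (1 / Λ) ^ 2 * wvar (P x a) (VstarJ P R j)) ≤ 2 * L
  frequency : ∀ k < K, ∀ x a y,
    ∑ y', (transitions R H K bonus ω k x a y' : ℝ)
      * (1 / (4 * (H : ℝ)) * (if y' = y then 1 else 0)
        - (1 / (4 * (H : ℝ)) + (1 / (4 * (H : ℝ))) ^ 2) * P x a y) ≤ 2 * L

/-- The truncated inverse-count correction of the bonus. -/
noncomputable def invCountClip (h C : ℝ) (n : ℕ) : ℝ :=
  if n = 0 then h ^ 2 else min (C / n) (h ^ 2)

lemma invCountClip_nonneg {h C : ℝ} (hC : 0 ≤ C) (n : ℕ) : 0 ≤ invCountClip h C n := by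
  unfold invCountClip
  split_ifs <;> positivity

lemma invCountClip_le (h C : ℝ) (n : ℕ) : invCountClip h C n ≤ h ^ 2 := by
  unfold invCountClip
  split_ifs
  · exact le_rfl
  · exact min_le_right _ _

variable {P R H bonus ω}

lemma bonusBF_eq {L : ℝ} {N : S → A → ℕ} {Phat : S → A → S → ℝ} {Npos : ℕ → S → ℕ} {j : ℕ}
    {V : S → ℝ} {x : S} {a : A} :
    bonusBF H (Fintype.card S) (Fintype.card A) L N Phat Npos j V x a
      = √(8 * L * wvar (Phat x a) V / N x a) + 14 * H * L / (3 * N x a)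
        + √(8 * (∑ y, Phat x a y * invCountClip H (100 ^ 2 * (H : ℝ) ^ 3 * (Fintype.card S : ℝ) ^ 2
            * (Fintype.card A : ℝ) * L ^ 2) (Npos (H - j) y)) / N x a) := rfl

lemma qstar_le (hP0 : ∀ x a y, 0 ≤ P x a y) (hP1 : ∀ x a, ∑ y, P x a y = 1)
    (hR1 : ∀ x a, R x a ≤ 1) {j : ℕ} (hj : j < H) (x : S) (a : A) :
    R x a + ∑ y, P x a y * VstarJ P R j y ≤ H := by
  have h1 := weighted_sum_le (hP0 x a) (hP1 x a) (VstarJ_le (P := P) (R := R) hP0 hP1 hR1 j)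
  have h2 : ((j + 1 : ℕ) : ℝ) ≤ H := by exact_mod_cast hj
  push_cast at h2
  linarith [hR1 x a]

lemma le_Qep_step {L Λ : ℝ}
    (hb : bonus = bonusBF H (Fintype.card S) (Fintype.card A) L) (hL : 1 / 4 ≤ L)
    (hP0 : ∀ x a y, 0 ≤ P x a y) (hP1 : ∀ x a, ∑ y, P x a y = 1)
    (hR0 : ∀ x a, 0 ≤ R x a) (hR1 : ∀ x a, R x a ≤ 1)
    (hω : TransitionsConcentrate P R H bonus ω L Λ) {k : ℕ} (hk : k < K) {j : ℕ} (hj : j < H)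
    (x : S) (a : A)
    (hprev : R x a + ∑ y, P x a y * VstarJ P R j y ≤ (epState R H K bonus ω k).2.2.2 (j + 1) x a)
    (hV : ∀ y, VstarJ P R j y ≤ optV R H bonus ω k j y) :
    R x a + ∑ y, P x a y * VstarJ P R j y ≤ Qep R H K bonus ω k (j + 1) x a := by
  have hQ := qstar_le hP0 hP1 hR1 hj x a
  rw [Qep_succ R H bonus ω hk]
  split_ifs with hn
  · exact hQ
  refine le_min hprev (le_min hQ ?_)
  set n := visits R H K bonus ω k x a with hndef
  have hn0 : (0 : ℝ) < n := by exact_mod_cast Nat.pos_of_ne_zero hn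
  have hH0 : (0 : ℝ) < H := by exact_mod_cast (Nat.zero_lt_of_lt hj)
  have hmain := le_sum_add_bernstein (p := empP R H K bonus ω k x a)
    (f := VstarJ P R j) (g := optV R H bonus ω k j) (h := H) (r := L / n)
    (m := ∑ y, P x a y * VstarJ P R j y)
    (empP_nonneg R H bonus ω k x a) (sum_empP R H bonus ω hk.le hn) hH0
    (div_pos (by linarith) hn0) (VstarJ_nonneg hP0 hR0 j) hV (optV_le R H bonus ω hk j)
    (by linarith [hR0 x a]) (by
      intro i hi lam hlam
      have hi' : i < Nat.log 2 (K * H) + 1 := by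
        refine Nat.lt_succ_of_le (Nat.le_log_of_pow_le (by norm_num) ?_)
        have h1 : (2 : ℝ) ^ i ≤ n := by
          have h2 : (2 : ℝ) ^ i * (4 * (L / n)) = 2 ^ i * (4 * L) / n := by ring
          rw [h2, div_le_one hn0] at hi
          have h3 : (2 : ℝ) ^ i * 1 ≤ 2 ^ i * (4 * L) :=
            mul_le_mul_of_nonneg_left (by linarith) (by positivity)
          linarith
        have h4 : 2 ^ i ≤ n := by exact_mod_cast h1
        exact h4.trans ((visits_le R H bonus ω hk.le x a).trans (Nat.mul_le_mul_right H hk.le))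
      have hE := hω.optimism k hk x a j hj i hi'
      rw [sum_empP_mul, hlam]
      calc _ ≤ 5 / 4 * L / n := div_le_div_of_nonneg_right hE hn0.le
        _ = 5 / 4 * (L / n) := by ring)
  rw [hb, bonusBF_eq, ← hb, ← hndef]
  have e1 : 8 * (L / n) * wvar (empP R H K bonus ω k x a) (optV R H bonus ω k j)
      = 8 * L * wvar (empP R H K bonus ω k x a) (optV R H bonus ω k j) / n := by ring
  have e2 : 14 / 3 * (H : ℝ) * (L / n) = 14 * H * L / (3 * n) := by field_simp
  rw [e1, e2] at hmain
  have h3 := Real.sqrt_nonneg (8 * (∑ y, empP R H K bonus ω k x a y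
    * invCountClip H (100 ^ 2 * (H : ℝ) ^ 3 * (Fintype.card S : ℝ) ^ 2
            * (Fintype.card A : ℝ) * L ^ 2) (posVisits R H K bonus ω k (H - j) y)) / n)
  linarith

/-- Optimism: on the concentration event the computed Q-values dominate the optimal ones. -/
lemma le_Qep_of_concentrate {L Λ : ℝ}
    (hb : bonus = bonusBF H (Fintype.card S) (Fintype.card A) L) (hL : 1 / 4 ≤ L)
    (hP0 : ∀ x a y, 0 ≤ P x a y) (hP1 : ∀ x a, ∑ y, P x a y = 1)
    (hR0 : ∀ x a, 0 ≤ R x a) (hR1 : ∀ x a, R x a ≤ 1)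
    (hω : TransitionsConcentrate P R H bonus ω L Λ) {k : ℕ} (hk : k < K) {j : ℕ} (hj : j < H)
    (x : S) (a : A) :
    R x a + ∑ y, P x a y * VstarJ P R j y ≤ Qep R H K bonus ω k (j + 1) x a := by
  induction k generalizing j x a with
  | zero =>
    induction j generalizing x a with
    | zero =>
      exact le_Qep_step hb hL hP0 hP1 hR0 hR1 hω hk hj x a (qstar_le hP0 hP1 hR1 hj x a)
        fun y => by rw [optV_zero R H bonus ω hk]; exact le_rfl
    | succ j ih =>
      exact le_Qep_step hb hL hP0 hP1 hR0 hR1 hω hk hj x a (qstar_le hP0 hP1 hR1 hj x a)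
        fun y => maxA_le fun b => (ih (by omega) y b).trans
          (le_maxA (fun b => Qep R H K bonus ω 0 (j + 1) y b) b)
  | succ k ihk =>
    induction j generalizing x a with
    | zero =>
      exact le_Qep_step hb hL hP0 hP1 hR0 hR1 hω hk hj x a (ihk (by omega) hj x a)
        fun y => by rw [optV_zero R H bonus ω hk]; exact le_rfl
    | succ j ih =>
      exact le_Qep_step hb hL hP0 hP1 hR0 hR1 hω hk hj x a (ihk (by omega) hj x a)
        fun y => maxA_le fun b => (ih (by omega) y b).trans
          (le_maxA (fun b => Qep R H K bonus ω (k + 1) (j + 1) y b) b)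

lemma VstarJ_le_optV {L Λ : ℝ}
    (hb : bonus = bonusBF H (Fintype.card S) (Fintype.card A) L) (hL : 1 / 4 ≤ L)
    (hP0 : ∀ x a y, 0 ≤ P x a y) (hP1 : ∀ x a, ∑ y, P x a y = 1)
    (hR0 : ∀ x a, 0 ≤ R x a) (hR1 : ∀ x a, R x a ≤ 1)
    (hω : TransitionsConcentrate P R H bonus ω L Λ) {k : ℕ} (hk : k < K) {j : ℕ} (hj : j ≤ H)
    (y : S) : VstarJ P R j y ≤ optV R H bonus ω k j y := by
  cases j with
  | zero => rw [optV_zero R H bonus ω hk]; exact le_rfl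
  | succ j =>
    exact maxA_le fun b => (le_Qep_of_concentrate hb hL hP0 hP1 hR0 hR1 hω hk hj y b).trans
      (le_maxA (fun b => Qep R H K bonus ω k (j + 1) y b) b)

variable (R H bonus ω) in
/-- Per-step cost of an episode: `H` at rarely visited pairs, otherwise lower-order bonus terms. -/
noncomputable def epCost (B E C : ℝ) (k j : ℕ) (x y : S) : ℝ :=
  if visits R H K bonus ω k x (polep R H K bonus ω k j x) < H then (H : ℝ)
  else B / visits R H K bonus ω k x (polep R H K bonus ω k j x)
    + 1.25 / E * invCountClip H C (posVisits R H K bonus ω k (H - (j - 1)) y)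

lemma epCost_nonneg {B E C : ℝ} (hB : 0 ≤ B) (hE : 0 < E) (hC : 0 ≤ C) (k j : ℕ) (x y : S) :
    0 ≤ epCost R H bonus ω B E C k j x y := by
  unfold epCost
  split_ifs
  · positivity
  · exact add_nonneg (by positivity) (mul_nonneg (by positivity) (invCountClip_nonneg hC _))

lemma optV_sub_VpolJ_succ_le {L Λ E : ℝ}
    (hb : bonus = bonusBF H (Fintype.card S) (Fintype.card A) L) (hL : 1 / 4 ≤ L)
    (hΛ : 18 * (H : ℝ) ^ 2 ≤ Λ) (hE : 0 < E)
    (hP0 : ∀ x a y, 0 ≤ P x a y) (hP1 : ∀ x a, ∑ y, P x a y = 1)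
    (hR0 : ∀ x a, 0 ≤ R x a) (hR1 : ∀ x a, R x a ≤ 1)
    (hω : TransitionsConcentrate P R H bonus ω L Λ) {k : ℕ} (hk : k < K) {j : ℕ} (hj : j < H)
    (x : S) (a : A) (ha : a = polep R H K bonus ω k (j + 1) x) :
    optV R H bonus ω k (j + 1) x - VpolJ P R (polep R H K bonus ω k) (j + 1) x
      ≤ (1 + 1 / (2 * (H : ℝ)))
          * ∑ y, P x a y * (optV R H bonus ω k j y - VpolJ P R (polep R H K bonus ω k) j y)
        + 4.5 / Λ * wvar (P x a) (VpolJ P R (polep R H K bonus ω k) j)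
        + ∑ y, P x a y * epCost R H bonus ω (invCoef (Fintype.card S) H L Λ E) E
            (100 ^ 2 * (H : ℝ) ^ 3 * (Fintype.card S : ℝ) ^ 2 * (Fintype.card A : ℝ) * L ^ 2)
            k (j + 1) x y := by
  set C := 100 ^ 2 * (H : ℝ) ^ 3 * (Fintype.card S : ℝ) ^ 2 * (Fintype.card A : ℝ) * L ^ 2 with hC
  have hC0 : 0 ≤ C := by positivity
  have hH1 : (1 : ℝ) ≤ H := by exact_mod_cast (Nat.one_le_iff_ne_zero.2 (by omega))
  have hΛ0 : 0 < Λ := lt_of_lt_of_le (by positivity) hΛ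
  set v := VpolJ P R (polep R H K bonus ω k) with hv
  set U := optV R H bonus ω k with hU
  have hfU : ∀ y, VstarJ P R j y ≤ U j y :=
    VstarJ_le_optV hb hL hP0 hP1 hR0 hR1 hω hk hj.le
  have hvf : ∀ y, v j y ≤ VstarJ P R j y := VpolJ_le_VstarJ hP0 _ j
  have hv0 : ∀ y, 0 ≤ v j y := VpolJ_nonneg hP0 hR0 _ j
  have hvar : 0 ≤ wvar (P x a) (v j) := wvar_nonneg (hP0 x a) (hP1 x a) _
  set n := visits R H K bonus ω k x a with hn
  by_cases hnH : n < H
  · have h1 : ∑ y, P x a y * epCost R H bonus ω (invCoef (Fintype.card S) H L Λ E) E C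
        k (j + 1) x y = H := by
      simp only [epCost, ← ha, ← hn, hnH, if_true, ← Finset.sum_mul, hP1, one_mul]
    rw [h1]
    have h2 : 0 ≤ ∑ y, P x a y * (U j y - v j y) :=
      Finset.sum_nonneg fun y _ => mul_nonneg (hP0 _ _ _) (by linarith [hfU y, hvf y])
    have h3 := optV_le R H bonus ω hk (j + 1) x
    have h4 : 0 ≤ v (j + 1) x := VpolJ_nonneg hP0 hR0 _ _ x
    have h5 : 0 ≤ (1 + 1 / (2 * (H : ℝ))) * ∑ y, P x a y * (U j y - v j y) := by positivity
    have h6 : 0 ≤ 4.5 / Λ * wvar (P x a) (v j) := by positivity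
    linarith
  · have hn1 : n ≠ 0 := by omega
    have hn0 : (0 : ℝ) < n := by exact_mod_cast Nat.pos_of_ne_zero hn1
    have hQ : U (j + 1) x ≤ R x a + (∑ y, empP R H K bonus ω k x a y * U j y)
        + bonus (visits R H K bonus ω k) (empP R H K bonus ω k) (posVisits R H K bonus ω k) j
            (U j) x a := by
      rw [hU, optV_eq_polep, ← ha, Qep_succ R H bonus ω hk, ← hn, if_neg hn1]
      exact (min_le_right _ _).trans (min_le_right _ _)
    have hbon : bonus (visits R H K bonus ω k) (empP R H K bonus ω k) (posVisits R H K bonus ω k) j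
        (U j) x a = √(8 * L * wvar (empP R H K bonus ω k x a) (U j) / n) + 14 * H * L / (3 * n)
        + √(8 * (∑ y, empP R H K bonus ω k x a y
          * invCountClip H C (posVisits R H K bonus ω k (H - j) y)) / n) := by
      conv_lhs => rw [hb, bonusBF_eq, ← hb]
    have hone := one_step_gap (p := P x a) (phat := empP R H K bonus ω k x a) (U := U j)
      (f := VstarJ P R j) (v := v j)
      (g := fun y => invCountClip H C (posVisits R H K bonus ω k (H - j) y))
      (h := H) (L := L) (Λ := Λ) (E := E) (n := n) (hP0 x a) (hP1 x a)
      (empP_nonneg R H bonus ω k x a) (sum_empP R H bonus ω hk.le hn1) hH1 (by linarith) hΛ hE hn0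
      hv0 hvf hfU (optV_le R H bonus ω hk j) (fun y => invCountClip_nonneg hC0 _)
      (fun y => invCountClip_le _ _ _)
      (by
        have h1 := hω.bernstein k hk x a j hj
        have h2 := div_le_div_of_nonneg_right h1 hn0.le
        rw [hn, ← sum_empP_mul] at h2
        refine le_trans (le_of_eq ?_) h2
        have h3 := sum_empP R H bonus ω hk.le hn1
        have h4 : ∀ y, empP R H K bonus ω k x a y
            * (1 / Λ * (VstarJ P R j y - ∑ z, P x a z * VstarJ P R j z)
              - (1 / Λ) ^ 2 * wvar (P x a) (VstarJ P R j))
            = 1 / Λ * (empP R H K bonus ω k x a y * VstarJ P R j y)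
              - (1 / Λ * (∑ z, P x a z * VstarJ P R j z)
                + (1 / Λ) ^ 2 * wvar (P x a) (VstarJ P R j)) * empP R H K bonus ω k x a y := by
          intro y; ring
        simp_rw [h4, Finset.sum_sub_distrib, ← Finset.mul_sum, h3]
        ring)
      (by
        intro y
        have h1 := hω.frequency k hk x a y
        have h2 := div_le_div_of_nonneg_right h1 hn0.le
        rw [hn, ← sum_empP_mul] at h2
        have h3 := sum_empP R H bonus ω hk.le hn1
        have h4 : ∑ y', empP R H K bonus ω k x a y'
            * (1 / (4 * (H : ℝ)) * (if y' = y then 1 else 0)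
              - (1 / (4 * (H : ℝ)) + (1 / (4 * (H : ℝ))) ^ 2) * P x a y)
            = 1 / (4 * (H : ℝ)) * (empP R H K bonus ω k x a y
              - (1 + 1 / (4 * (H : ℝ))) * P x a y) := by
          simp_rw [mul_sub, Finset.sum_sub_distrib, ← Finset.sum_mul, h3]
          simp
          ring
        rw [h4, ← hn] at h2
        have h5 := mul_le_mul_of_nonneg_left h2 (by positivity : 0 ≤ 4 * (H : ℝ))
        have h6 : 4 * (H : ℝ) * (1 / (4 * (H : ℝ)) * (empP R H K bonus ω k x a y
              - (1 + 1 / (4 * (H : ℝ))) * P x a y)) = empP R H K bonus ω k x a y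
              - (1 + 1 / (4 * (H : ℝ))) * P x a y := by field_simp
        have h7 : 4 * (H : ℝ) * (2 * L / n) = 8 * H * L / n := by ring
        linarith)
    have hV : v (j + 1) x = R x a + ∑ y, P x a y * v j y := by rw [ha]; rfl
    have hcost : ∑ y, P x a y * epCost R H bonus ω (invCoef (Fintype.card S) H L Λ E) E C
        k (j + 1) x y = invCoef (Fintype.card S) H L Λ E / n
          + 1.25 / E * ∑ y, P x a y * invCountClip H C (posVisits R H K bonus ω k (H - j) y) := by
      simp only [epCost, ← ha, ← hn, hnH, if_false, mul_add, Finset.sum_add_distrib,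
        ← Finset.sum_mul, hP1, one_mul, Nat.add_sub_cancel, Finset.mul_sum]
      congr 1
      exact Finset.sum_congr rfl fun y _ => by ring
    rw [hcost, hV]
    rw [hbon] at hQ
    linarith

/-- Unrolled gap bound over a full episode. -/
lemma optV_sub_VpolJ_le {L Λ E : ℝ}
    (hb : bonus = bonusBF H (Fintype.card S) (Fintype.card A) L) (hL : 1 / 4 ≤ L)
    (hΛ : 18 * (H : ℝ) ^ 2 ≤ Λ) (hE : 0 < E)
    (hP0 : ∀ x a y, 0 ≤ P x a y) (hP1 : ∀ x a, ∑ y, P x a y = 1)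
    (hR0 : ∀ x a, 0 ≤ R x a) (hR1 : ∀ x a, R x a ≤ 1)
    (hω : TransitionsConcentrate P R H bonus ω L Λ) {k : ℕ} (hk : k < K) {j : ℕ} (hj : j ≤ H)
    (x : S) :
    optV R H bonus ω k j x - VpolJ P R (polep R H K bonus ω k) j x
      ≤ (1 + 1 / (2 * (H : ℝ))) ^ j
        * (4.5 / Λ * expSum (epKernel P R H K bonus ω k) (stepVar P R (polep R H K bonus ω k)) j x
          + expSum (epKernel P R H K bonus ω k)
            (epCost R H bonus ω (invCoef (Fintype.card S) H L Λ E) E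
            (100 ^ 2 * (H : ℝ) ^ 3 * (Fintype.card S : ℝ) ^ 2 * (Fintype.card A : ℝ) * L ^ 2) k)
            j x) := by
  set C := 100 ^ 2 * (H : ℝ) ^ 3 * (Fintype.card S : ℝ) ^ 2 * (Fintype.card A : ℝ) * L ^ 2 with hC
  have hC0 : 0 ≤ C := by positivity
  have hΛ0 : 0 ≤ Λ := le_trans (by positivity) hΛ
  set B := invCoef (Fintype.card S) H L Λ E with hB
  have hB0 : 0 ≤ B := by
    rw [hB, invCoef]
    have : 0 ≤ L := by linarith
    positivity
  induction j generalizing x with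
  | zero => simp [expSum, VpolJ, optV_zero R H bonus ω hk]
  | succ j ih =>
    set a := polep R H K bonus ω k (j + 1) x with ha
    have h1 := optV_sub_VpolJ_succ_le hb hL hΛ hE hP0 hP1 hR0 hR1 hω hk hj x a ha
    rw [← hC, ← hB] at h1
    set ρ : ℝ := 1 + 1 / (2 * (H : ℝ)) with hρ
    have hρ1 : 1 ≤ ρ := by rw [hρ]; linarith [show 0 ≤ 1 / (2 * (H : ℝ)) by positivity]
    have hvar : 0 ≤ 4.5 / Λ * wvar (P x a) (VpolJ P R (polep R H K bonus ω k) j) :=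
      mul_nonneg (by positivity) (wvar_nonneg (hP0 x a) (hP1 x a) _)
    have hcost : 0 ≤ ∑ y, P x a y * epCost R H bonus ω B E C k (j + 1) x y :=
      Finset.sum_nonneg fun y _ => mul_nonneg (hP0 _ _ _) (epCost_nonneg hB0 hE hC0 _ _ _ _)
    have hs1 : expSum (epKernel P R H K bonus ω k) (stepVar P R (polep R H K bonus ω k)) (j + 1) x
        = wvar (P x a) (VpolJ P R (polep R H K bonus ω k) j)
          + ∑ y, P x a y * expSum (epKernel P R H K bonus ω k)
            (stepVar P R (polep R H K bonus ω k)) j y := expSum_stepVar_succ hP1 _ j x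
    have hs2 : expSum (epKernel P R H K bonus ω k) (epCost R H bonus ω B E C k) (j + 1) x
        = ∑ y, P x a y * epCost R H bonus ω B E C k (j + 1) x y
          + ∑ y, P x a y * expSum (epKernel P R H K bonus ω k)
            (epCost R H bonus ω B E C k) j y := by
      simp only [expSum, mul_add, Finset.sum_add_distrib]
      rfl
    have h2 : ∑ y, P x a y * (optV R H bonus ω k j y - VpolJ P R (polep R H K bonus ω k) j y)
        ≤ ρ ^ j * (4.5 / Λ * ∑ y, P x a y * expSum (epKernel P R H K bonus ω k)
            (stepVar P R (polep R H K bonus ω k)) j y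
          + ∑ y, P x a y * expSum (epKernel P R H K bonus ω k)
            (epCost R H bonus ω B E C k) j y) := by
      rw [Finset.mul_sum, ← Finset.sum_add_distrib, Finset.mul_sum]
      refine Finset.sum_le_sum fun y _ => ?_
      have := mul_le_mul_of_nonneg_left (ih (by omega) y) (hP0 x a y)
      linarith
    have h3 := mul_le_mul_of_nonneg_left h2 (by linarith : 0 ≤ ρ)
    have h4 : 1 * (4.5 / Λ * wvar (P x a) (VpolJ P R (polep R H K bonus ω k) j)
        + ∑ y, P x a y * epCost R H bonus ω B E C k (j + 1) x y)
        ≤ ρ ^ (j + 1) * (4.5 / Λ * wvar (P x a) (VpolJ P R (polep R H K bonus ω k) j)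
        + ∑ y, P x a y * epCost R H bonus ω B E C k (j + 1) x y) :=
      mul_le_mul_of_nonneg_right (one_le_pow₀ hρ1) (by linarith)
    rw [hs1, hs2]
    have e : ρ ^ (j + 1) = ρ * ρ ^ j := by ring
    rw [e] at h4 ⊢
    linarith

lemma one_add_half_inv_pow_le (hH : 1 ≤ H) : (1 + 1 / (2 * (H : ℝ))) ^ H ≤ 1.65 := by
  have hH0 : (0 : ℝ) < H := by exact_mod_cast hH
  have h1 : 1 + 1 / (2 * (H : ℝ)) ≤ Real.exp (1 / (2 * (H : ℝ))) := by
    linarith [Real.add_one_le_exp (1 / (2 * (H : ℝ)))]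
  calc (1 + 1 / (2 * (H : ℝ))) ^ H ≤ Real.exp (1 / (2 * (H : ℝ))) ^ H :=
        pow_le_pow_left₀ (by positivity) h1 H
    _ = Real.exp (1 / 2) := by
        rw [← Real.exp_nat_mul]
        congr 1
        field_simp
    _ ≤ 1.65 := by
        have h2 : Real.exp (1 / 2) ^ 2 = Real.exp 1 := by
          rw [← Real.exp_nat_mul]
          norm_num
        have h3 := Real.exp_one_lt_d9
        have h4 := Real.exp_pos (1 / 2)
        nlinarith

/-- Per-episode regret bound on the concentration event. -/
lemma VstarJ_sub_VpolJ_le {L Λ E : ℝ}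
    (hb : bonus = bonusBF H (Fintype.card S) (Fintype.card A) L) (hL : 1 / 4 ≤ L) (hH : 1 ≤ H)
    (hΛ : 18 * (H : ℝ) ^ 2 ≤ Λ) (hE : 0 < E)
    (hP0 : ∀ x a y, 0 ≤ P x a y) (hP1 : ∀ x a, ∑ y, P x a y = 1)
    (hR0 : ∀ x a, 0 ≤ R x a) (hR1 : ∀ x a, R x a ≤ 1)
    (hω : TransitionsConcentrate P R H bonus ω L Λ) {k : ℕ} (hk : k < K) (x : S) :
    VstarJ P R H x - VpolJ P R (polep R H K bonus ω k) H x
      ≤ 1.65 * (4.5 / Λ * ((H : ℝ) ^ 2 / 4)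
          + expSum (epKernel P R H K bonus ω k)
            (epCost R H bonus ω (invCoef (Fintype.card S) H L Λ E) E
            (100 ^ 2 * (H : ℝ) ^ 3 * (Fintype.card S : ℝ) ^ 2 * (Fintype.card A : ℝ) * L ^ 2) k)
            H x) := by
  have hΛ0 : 0 ≤ Λ := le_trans (by positivity) hΛ
  have hL0 : 0 ≤ L := by linarith
  have h1 := VstarJ_le_optV hb hL hP0 hP1 hR0 hR1 hω hk le_rfl x
  have h2 := optV_sub_VpolJ_le hb hL hΛ hE hP0 hP1 hR0 hR1 hω hk le_rfl x
  have h3 : expSum (epKernel P R H K bonus ω k) (stepVar P R (polep R H K bonus ω k)) H x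
      ≤ (H : ℝ) ^ 2 / 4 := expSum_stepVar_le hP0 hP1 hR0 hR1 _ H x
  have h4 : 0 ≤ expSum (epKernel P R H K bonus ω k)
      (epCost R H bonus ω (invCoef (Fintype.card S) H L Λ E) E
        (100 ^ 2 * (H : ℝ) ^ 3 * (Fintype.card S : ℝ) ^ 2 * (Fintype.card A : ℝ) * L ^ 2) k) H x := by
    refine expSum_nonneg (fun j x y => hP0 _ _ _) (fun j x y => epCost_nonneg ?_ hE ?_ _ _ _ _) H x
    · rw [invCoef]; positivity
    · positivity
  have h5 := mul_le_mul_of_nonneg_left h3 (by positivity : 0 ≤ 4.5 / Λ)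
  have h6 := mul_le_mul (one_add_half_inv_pow_le hH) (add_le_add_left h5
    (expSum (epKernel P R H K bonus ω k)
      (epCost R H bonus ω (invCoef (Fintype.card S) H L Λ E) E
        (100 ^ 2 * (H : ℝ) ^ 3 * (Fintype.card S : ℝ) ^ 2 * (Fintype.card A : ℝ) * L ^ 2) k) H x))
    (add_nonneg (mul_nonneg (by positivity) (expSum_nonneg (fun j x y => hP0 _ _ _)
      (fun j x y => wvar_nonneg (hP0 _ _) (hP1 _ _) _) H x)) h4) (by norm_num)
  linarith

end Algorithm

section Counting

set_option linter.unusedSectionVars false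

lemma sum_le_of_le_sub {K : ℕ} {f : Fin K → ℝ} {g : ℕ → ℝ} (h : ∀ k, f k ≤ g (k.val + 1) - g k.val) :
    ∑ k, f k ≤ g K - g 0 := by
  rw [← Finset.sum_range_sub, ← Fin.sum_univ_eq_sum_range (fun k => g (k + 1) - g k) K]
  exact Finset.sum_le_sum fun k _ => h k

/-- Potential dominating the visit-count part of the episode costs. -/
noncomputable def visitPotential (h B n : ℝ) : ℝ :=
  h * min n (2 * h) + 2 * B * Real.log (max n h / h)

lemma visitPotential_zero {h : ℝ} (hh : 0 < h) (B : ℝ) : visitPotential h B 0 = 0 := by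
  unfold visitPotential
  rw [min_eq_left (by positivity), max_eq_right hh.le, div_self hh.ne']
  simp

lemma visitPotential_le {h B n c : ℝ} (hh : 0 < h) (hB : 0 ≤ B) (hc : 1 ≤ c) (hn : n ≤ c * h) :
    visitPotential h B n ≤ 2 * h ^ 2 + 2 * B * Real.log c := by
  unfold visitPotential
  have h1 : h * min n (2 * h) ≤ 2 * h ^ 2 := by nlinarith [min_le_right n (2 * h)]
  have h2 : max n h / h ≤ c := by
    rw [div_le_iff₀ hh]
    exact max_le hn (by nlinarith)
  have h3 : 0 < max n h / h := div_pos (lt_max_of_lt_right hh) hh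
  have := Real.log_le_log h3 h2
  gcongr

lemma mul_le_visitPotential_sub {h B n m : ℝ} (hh : 0 < h) (hB : 0 ≤ B) (hm : 0 ≤ m)
    (hmh : m ≤ h) :
    (if n < h then h else B / n) * m ≤ visitPotential h B (n + m) - visitPotential h B n := by
  unfold visitPotential
  split_ifs with hnh
  · rw [min_eq_left (by linarith : n + m ≤ 2 * h), min_eq_left (by linarith : n ≤ 2 * h)]
    have : Real.log (max n h / h) ≤ Real.log (max (n + m) h / h) := by
      refine Real.log_le_log (div_pos (lt_max_of_lt_right hh) hh) ?_
      gcongr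
      linarith
    nlinarith
  · push Not at hnh
    have hn : 0 < n := hh.trans_le hnh
    rw [max_eq_left hnh, max_eq_left (by linarith : h ≤ n + m),
      Real.log_div (by positivity) hh.ne', Real.log_div hn.ne' hh.ne']
    have h1 : h * min n (2 * h) ≤ h * min (n + m) (2 * h) := by
      gcongr
      linarith
    have h2 : m / (2 * n) ≤ Real.log (n + m) - Real.log n := by
      rw [← Real.log_div (by positivity) hn.ne']
      refine le_trans ?_ (Real.one_sub_inv_le_log_of_pos (by positivity))
      rw [inv_div, one_sub_div (by positivity), add_sub_cancel_left]
      gcongr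
      linarith
    have h3 : B / n * m = 2 * B * (m / (2 * n)) := by field_simp
    rw [h3]
    nlinarith

lemma sum_invCountClip_le (h : ℝ) {C : ℝ} (hC : 0 ≤ C) {n K : ℕ} (hn : n ≤ K) :
    ∑ i ∈ Finset.range n, invCountClip h C i ≤ h ^ 2 + C * (1 + Real.log K) := by
  have h1 : ∑ i ∈ Finset.range n, invCountClip h C i
      ≤ ∑ i ∈ Finset.range (K + 1), invCountClip h C i :=
    Finset.sum_le_sum_of_subset_of_nonneg (Finset.range_mono (by omega))
      fun i _ _ => invCountClip_nonneg hC i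
  refine h1.trans ?_
  rw [Finset.sum_range_succ', add_comm]
  refine add_le_add (invCountClip_le _ _ _) ?_
  refine le_trans ?_ (mul_le_mul_of_nonneg_left (harmonic_le_one_add_log K) hC)
  rw [harmonic]
  push_cast
  rw [Finset.mul_sum]
  refine Finset.sum_le_sum fun i _ => ?_
  unfold invCountClip
  rw [if_neg (by omega)]
  refine (min_le_left _ _).trans (le_of_eq ?_)
  push_cast
  rfl

variable {S A : Type*} [Fintype S] [Fintype A] [DecidableEq S] [DecidableEq A]
  [Nonempty A]
  {R : S → A → ℝ} {H K : ℕ}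
  {bonus : (S → A → ℕ) → (S → A → S → ℝ) → (ℕ → S → ℕ) → ℕ → (S → ℝ) → S → A → ℝ}
  {ω : Fin K → Fin (H + 1) → S}

lemma posVisits_le {k : ℕ} (hk : k ≤ K) {q : ℕ} (hq : q < H + 1) (y : S) :
    posVisits R H K bonus ω k q y ≤ k := by
  induction k with
  | zero => simp [posVisits, epState]
  | succ k ih =>
    rw [posVisits_succ R H bonus ω k hk q hq]
    have := ih (by omega)
    split_ifs <;> omega

lemma pathSum_hitWeight_nonneg (x : S) (a : A) (k : ℕ) (τ : Fin (H + 1) → S) :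
    0 ≤ pathSum (hitWeight R H K bonus ω x a (fun _ => 1) k) H τ := by
  unfold pathSum hitWeight
  exact Finset.sum_nonneg fun p _ => by split_ifs <;> norm_num

/-- Costs depending on the visit counts only, summed over pairs. -/
lemma pathSum_visits_eq (F : ℕ → ℝ) (k : ℕ) (τ : Fin (H + 1) → S) :
    pathSum (fun j x _ => F (visits R H K bonus ω k x (polep R H K bonus ω k j x))) H τ
      = ∑ x, ∑ a, F (visits R H K bonus ω k x a)
        * pathSum (hitWeight R H K bonus ω x a (fun _ => 1) k) H τ := by
  unfold pathSum hitWeight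
  simp_rw [Finset.mul_sum]
  have : ∀ x : S, ∑ a : A, ∑ p : Fin H, (F (visits R H K bonus ω k x a) *
      if τ p.castSucc = x ∧ polep R H K bonus ω k (H - p.val) (τ p.castSucc) = a then (1 : ℝ) else 0)
      = ∑ p : Fin H, ∑ a : A, (F (visits R H K bonus ω k x a) *
      if τ p.castSucc = x ∧ polep R H K bonus ω k (H - p.val) (τ p.castSucc) = a
        then (1 : ℝ) else 0) := fun x => Finset.sum_comm
  simp_rw [this]
  rw [Finset.sum_comm]
  refine Finset.sum_congr rfl fun p _ => ?_
  rw [Finset.sum_eq_single (τ p.castSucc) (fun x _ hx => by simp [hx.symm]) (by simp),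
    Finset.sum_eq_single (polep R H K bonus ω k (H - p.val) (τ p.castSucc))
      (fun a _ ha => by simp [ha.symm]) (by simp)]
  simp

lemma sum_pathSum_visits_le (hH : 1 ≤ H) (hK : 1 ≤ K) {B : ℝ} (hB : 0 ≤ B) :
    ∑ k : Fin K, pathSum (fun j x _ =>
        if (visits R H K bonus ω k x (polep R H K bonus ω k j x) : ℝ) < H then (H : ℝ)
        else B / (visits R H K bonus ω k x (polep R H K bonus ω k j x) : ℝ)) H (ω k)
      ≤ Fintype.card S * Fintype.card A * (2 * (H : ℝ) ^ 2 + 2 * B * Real.log K) := by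
  have hH0 : (0 : ℝ) < H := by exact_mod_cast hH
  have h1 : ∀ k : Fin K, pathSum (fun j x _ =>
        if (visits R H K bonus ω k x (polep R H K bonus ω k j x) : ℝ) < H then (H : ℝ)
        else B / (visits R H K bonus ω k x (polep R H K bonus ω k j x) : ℝ)) H (ω k)
      = ∑ x, ∑ a, (if (visits R H K bonus ω k x a : ℝ) < H then (H : ℝ)
        else B / (visits R H K bonus ω k x a : ℝ))
        * pathSum (hitWeight R H K bonus ω x a (fun _ => 1) k) H (ω k) := fun k =>
    pathSum_visits_eq (fun n => if (n : ℝ) < H then (H : ℝ) else B / (n : ℝ)) k (ω k)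
  simp_rw [h1]
  rw [Finset.sum_comm]
  simp_rw [Finset.sum_comm (s := (Finset.univ : Finset (Fin K)))]
  have h2 : ∀ x a, ∑ k : Fin K, (if (visits R H K bonus ω k x a : ℝ) < H then (H : ℝ)
        else B / (visits R H K bonus ω k x a : ℝ))
        * pathSum (hitWeight R H K bonus ω x a (fun _ => 1) k) H (ω k)
      ≤ 2 * (H : ℝ) ^ 2 + 2 * B * Real.log K := by
    intro x a
    refine (sum_le_of_le_sub (g := fun k => visitPotential H B (visits R H K bonus ω k x a)) ?_).trans
      ?_
    · intro k
      rw [visits_succ R H bonus ω k.val k.isLt]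
      exact mul_le_visitPotential_sub hH0 hB (pathSum_hitWeight_nonneg x a k _)
        (pathSum_hitWeight_le R H bonus ω x a k _)
    · have h3 : (visits R H K bonus ω 0 x a : ℝ) = 0 := by simp [visits, epState]
      simp only [h3, visitPotential_zero hH0, sub_zero]
      refine visitPotential_le hH0 hB (by exact_mod_cast hK) ?_
      exact_mod_cast visits_le R H bonus ω le_rfl x a
  calc _ ≤ ∑ x : S, ∑ a : A, (2 * (H : ℝ) ^ 2 + 2 * B * Real.log K) :=
        Finset.sum_le_sum fun x _ => Finset.sum_le_sum fun a _ => h2 x a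
    _ = _ := by simp only [Finset.sum_const, Finset.card_univ, nsmul_eq_mul, mul_assoc]

lemma sum_pathSum_posVisits_le {C : ℝ} (hC : 0 ≤ C) :
    ∑ k : Fin K, pathSum (fun j _ y =>
        invCountClip H C (posVisits R H K bonus ω k (H - (j - 1)) y)) H (ω k)
      ≤ H * (Fintype.card S * ((H : ℝ) ^ 2 + C * (1 + Real.log K))) := by
  unfold pathSum
  rw [Finset.sum_comm]
  have h1 : ∀ p : Fin H, ∑ k : Fin K, invCountClip H C
        (posVisits R H K bonus ω k (H - (H - p.val - 1)) (ω k p.succ))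
      ≤ Fintype.card S * ((H : ℝ) ^ 2 + C * (1 + Real.log K)) := by
    intro p
    have hp : H - (H - p.val - 1) = p.val + 1 := by omega
    rw [hp]
    have h2 : ∀ k : Fin K, invCountClip H C (posVisits R H K bonus ω k (p.val + 1) (ω k p.succ))
        = ∑ y, if ω k p.succ = y then invCountClip H C (posVisits R H K bonus ω k (p.val + 1) y)
          else 0 := by
      intro k
      simp
    simp_rw [h2]
    rw [Finset.sum_comm]
    have h3 : ∀ y, ∑ k : Fin K, (if ω k p.succ = y then
        invCountClip H C (posVisits R H K bonus ω k (p.val + 1) y) else 0)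
        ≤ (H : ℝ) ^ 2 + C * (1 + Real.log K) := by
      intro y
      refine (sum_le_of_le_sub (g := fun k => ∑ i ∈ Finset.range
        (posVisits R H K bonus ω k (p.val + 1) y), invCountClip H C i) ?_).trans ?_
      · intro k
        rw [posVisits_succ R H bonus ω k.val k.isLt (p.val + 1) (by omega)]
        have : (⟨p.val + 1, by omega⟩ : Fin (H + 1)) = p.succ := rfl
        rw [this]
        by_cases h : ω k p.succ = y
        · simp [h, Finset.sum_range_succ]
        · simp [h]
      · have h4 : posVisits R H K bonus ω 0 (p.val + 1) y = 0 := by simp [posVisits, epState]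
        simp only [h4, Finset.range_zero, Finset.sum_empty, sub_zero]
        exact sum_invCountClip_le _ hC (posVisits_le le_rfl (by omega) y)
    calc _ ≤ ∑ y : S, ((H : ℝ) ^ 2 + C * (1 + Real.log K)) := Finset.sum_le_sum fun y _ => h3 y
      _ = _ := by simp only [Finset.sum_const, Finset.card_univ, nsmul_eq_mul]
  calc _ ≤ ∑ p : Fin H, (Fintype.card S : ℝ) * ((H : ℝ) ^ 2 + C * (1 + Real.log K)) :=
        Finset.sum_le_sum fun p _ => h1 p
    _ = _ := by simp only [Finset.sum_const, Finset.card_univ, Fintype.card_fin, nsmul_eq_mul]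

/-- The realized costs over all episodes are logarithmic in the number of episodes. -/
lemma sum_pathSum_epCost_le (hH : 1 ≤ H) (hK : 1 ≤ K) {B E C : ℝ} (hB : 0 ≤ B) (hE : 0 < E)
    (hC : 0 ≤ C) :
    ∑ k : Fin K, pathSum (epCost R H bonus ω B E C k) H (ω k)
      ≤ Fintype.card S * Fintype.card A * (2 * (H : ℝ) ^ 2 + 2 * B * Real.log K)
        + 1.25 / E * (H * (Fintype.card S * ((H : ℝ) ^ 2 + C * (1 + Real.log K)))) := by
  refine le_trans ?_ (add_le_add (sum_pathSum_visits_le (R := R) (bonus := bonus) (ω := ω) hH hK hB)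
    (mul_le_mul_of_nonneg_left (sum_pathSum_posVisits_le (R := R) (bonus := bonus) (ω := ω) hC)
      (by positivity : 0 ≤ 1.25 / E)))
  rw [Finset.mul_sum, ← Finset.sum_add_distrib]
  refine Finset.sum_le_sum fun k _ => ?_
  unfold pathSum
  rw [Finset.mul_sum, ← Finset.sum_add_distrib]
  refine Finset.sum_le_sum fun p _ => ?_
  unfold epCost
  have h1 := invCountClip_nonneg (h := H) hC
    (posVisits R H K bonus ω k (H - (H - p.val - 1)) (ω k p.succ))
  have h2 : 0 ≤ 1.25 / E * invCountClip H C
    (posVisits R H K bonus ω k (H - (H - p.val - 1)) (ω k p.succ)) := by positivity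
  by_cases h : visits R H K bonus ω k (ω k p.castSucc)
      (polep R H K bonus ω k (H - p.val) (ω k p.castSucc)) < H
  · have h' : (visits R H K bonus ω k (ω k p.castSucc)
      (polep R H K bonus ω k (H - p.val) (ω k p.castSucc)) : ℝ) < H := by exact_mod_cast h
    simp only [h, h', if_true]
    linarith
  · have h' : ¬ (visits R H K bonus ω k (ω k p.castSucc)
      (polep R H K bonus ω k (H - p.val) (ω k p.castSucc)) : ℝ) < H := by exact_mod_cast h
    simp only [h, h', if_false]
    exact le_rfl

lemma pathSum_epCost_le (hH : 1 ≤ H) {B E C : ℝ} (hB : 0 ≤ B) (hE : 0 < E) (k : ℕ)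
    (τ : Fin (H + 1) → S) :
    pathSum (epCost R H bonus ω B E C k) H τ ≤ B + (H : ℝ) ^ 2 + 1.25 / E * (H : ℝ) ^ 3 := by
  have hH0 : (0 : ℝ) < H := by exact_mod_cast hH
  have h1 : ∀ j x y, epCost R H bonus ω B E C k j x y ≤ B / H + H + 1.25 / E * (H : ℝ) ^ 2 := by
    intro j x y
    unfold epCost
    split_ifs with h
    · have : 0 ≤ B / H + 1.25 / E * (H : ℝ) ^ 2 := by positivity
      linarith
    · push Not at h
      have h2 : (H : ℝ) ≤ visits R H K bonus ω k x (polep R H K bonus ω k j x) := by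
        exact_mod_cast h
      have h3 := invCountClip_le H C (posVisits R H K bonus ω k (H - (j - 1)) y)
      have h4 : B / (visits R H K bonus ω k x (polep R H K bonus ω k j x) : ℝ) ≤ B / H := by
        gcongr
      have h5 : 1.25 / E * invCountClip H C (posVisits R H K bonus ω k (H - (j - 1)) y)
        ≤ 1.25 / E * (H : ℝ) ^ 2 := by gcongr
      linarith
  calc _ ≤ ∑ p : Fin H, (B / H + H + 1.25 / E * (H : ℝ) ^ 2) := Finset.sum_le_sum fun p _ => h1 _ _ _
    _ = _ := by
      simp only [Finset.sum_const, Finset.card_univ, Fintype.card_fin, nsmul_eq_mul]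
      field_simp

lemma epCost_update (B E C : ℝ) (m : Fin K) (τ : Fin (H + 1) → S) (k : ℕ) (hk : k ≤ m.val) :
    epCost R H bonus (Function.update ω m τ) B E C k = epCost R H bonus ω B E C k := by
  unfold epCost visits posVisits
  rw [polep_update R H K bonus ω m τ k hk, epState_update R H K bonus ω m τ k hk]

end Counting

section Arithmetic

lemma invCoef_nonneg {s h L Λ E : ℝ} (hs : 0 ≤ s) (hh : 0 ≤ h) (hL : 0 ≤ L) (hΛ : 0 ≤ Λ)
    (hE : 0 ≤ E) : 0 ≤ invCoef s h L Λ E := by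
  unfold invCoef
  positivity

lemma invCoef_le {h s l L q t : ℝ} (hh : 1 ≤ h) (hs : 1 ≤ s) (hl : 1 ≤ l) (hlL : l ≤ L)
    (hq : 1 ≤ q) (ht : 0 ≤ t) :
    invCoef s h l (h * t / (4 * L * q) + 18 * h ^ 2) (50 * h ^ 2 * s * L)
      ≤ h * t / q + 186 * (h ^ 2 * s * L) := by
  have hL : 1 ≤ L := hl.trans hlL
  unfold invCoef
  have h1 : 4 * l * (h * t / (4 * L * q) + 18 * h ^ 2) ≤ h * t / q + 72 * (h ^ 2 * s * L) := by
    have h2 : 4 * l * (h * t / (4 * L * q)) ≤ 4 * L * (h * t / (4 * L * q)) := by gcongr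
    have h3 : 4 * L * (h * t / (4 * L * q)) = h * t / q := by field_simp
    have h4 : h ^ 2 * l ≤ h ^ 2 * s * L := by
      calc h ^ 2 * l ≤ h ^ 2 * L := by gcongr
        _ = h ^ 2 * 1 * L := by ring
        _ ≤ _ := by gcongr
    linarith
  have h2 : 8 * s * h ^ 2 * l ≤ 8 * (h ^ 2 * s * L) := by
    calc 8 * s * h ^ 2 * l ≤ 8 * s * h ^ 2 * L := by gcongr
      _ = _ := by ring
  have h3 : h * l ≤ h ^ 2 * s * L := by
    calc h * l ≤ h * L := by gcongr
      _ = h * 1 * 1 * L := by ring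
      _ ≤ h * h * s * L := by gcongr
      _ = _ := by ring
  have h4 : 1 / (h * t / (4 * L * q) + 18 * h ^ 2) ≤ 1 / (18 * h ^ 2) := by
    have : 0 ≤ h * t / (4 * L * q) := by positivity
    gcongr
    linarith
  have h5 : 1 / (50 * h ^ 2 * s * L) ≤ 1 / (50 * h ^ 2) := by
    refine one_div_le_one_div_of_le (by positivity) ?_
    calc 50 * h ^ 2 = 50 * h ^ 2 * 1 * 1 := by ring
      _ ≤ _ := by gcongr
  have h6 : (1 / (h * t / (4 * L * q) + 18 * h ^ 2) + 1 / (50 * h ^ 2 * s * L))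
      * (8 * s * h ^ 3 * l) ≤ 0.7 * (h ^ 2 * s * L) := by
    calc _ ≤ (1 / (18 * h ^ 2) + 1 / (50 * h ^ 2)) * (8 * s * h ^ 3 * L) := by gcongr
      _ = (8 / 18 + 8 / 50) * (h * 1 * s * L) := by field_simp
      _ ≤ 0.7 * (h * h * s * L) := by gcongr; norm_num
      _ = _ := by ring
  have h7 : 0 ≤ h ^ 2 * s * L := by positivity
  have h8 : 14 * h * l / 3 = 14 / 3 * (h * l) := by ring
  linarith

lemma regret_arith {h s a k l L lk : ℝ} (hh : 1 ≤ h) (hs : 1 ≤ s) (ha : 1 ≤ a) (hk : 1 ≤ k)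
    (hl : 1 ≤ l) (hlL : l ≤ L) (hlk0 : 0 ≤ lk) (hlk : 1 + lk ≤ l) {Λ E C B : ℝ}
    (hΛ : Λ = h * √k / (4 * L * √(s * a)) + 18 * h ^ 2) (hE : E = 50 * h ^ 2 * s * L)
    (hC : C = 100 ^ 2 * h ^ 3 * s ^ 2 * a * l ^ 2) (hB : B = invCoef s h l Λ E) :
    1.65 * (k * (4.5 / Λ * (h ^ 2 / 4)) + 8 / 5 * ((s * a * (2 * h ^ 2 + 2 * B * lk)
        + 1.25 / E * (h * (s * (h ^ 2 + C * (1 + lk)))))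
        + (B + h ^ 2 + 1.25 / E * h ^ 3) * l))
      ≤ 30 * h * L * √(s * a * k) + 2500 * h ^ 2 * s ^ 2 * a * L ^ 2 := by
  have hL : 1 ≤ L := hl.trans hlL
  have hsa : 1 ≤ s * a := one_le_mul_of_one_le_of_one_le hs ha
  obtain ⟨q, hq⟩ : ∃ q, q = √(s * a) := ⟨_, rfl⟩
  obtain ⟨t, ht⟩ : ∃ t, t = √k := ⟨_, rfl⟩
  have hq1 : 1 ≤ q := by rw [hq]; exact Real.one_le_sqrt.2 hsa
  have ht1 : 1 ≤ t := by rw [ht]; exact Real.one_le_sqrt.2 hk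
  have hqq : q ^ 2 = s * a := by rw [hq]; exact Real.sq_sqrt (by positivity)
  have htt : t ^ 2 = k := by rw [ht]; exact Real.sq_sqrt (by positivity)
  rw [Real.sqrt_mul (by positivity), ← hq, ← ht]
  rw [← hq, ← ht] at hΛ
  have hX : 0 ≤ h ^ 2 * s ^ 2 * a * L ^ 2 := by positivity
  have hBle : B ≤ h * t / q + 186 * (h ^ 2 * s * L) := by
    rw [hB, hΛ, hE]
    exact invCoef_le hh hs hl hlL hq1 (by positivity)
  have hB0 : 0 ≤ B := by
    rw [hB, hΛ, hE]
    exact invCoef_nonneg (by positivity) (by positivity) (by positivity) (by positivity)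
      (by positivity)
  have h1 : k * (4.5 / Λ * (h ^ 2 / 4)) ≤ 4.5 * (h * L * (q * t)) := by
    have : 4.5 / Λ ≤ 4.5 / (h * t / (4 * L * q)) := by
      rw [hΛ]
      gcongr
      have : 0 ≤ h ^ 2 := by positivity
      linarith
    calc _ ≤ t ^ 2 * (4.5 / (h * t / (4 * L * q)) * (h ^ 2 / 4)) := by rw [htt]; gcongr
      _ = _ := by field_simp
  have h2 : s * a * (2 * B * lk) + B * l ≤ 3 * (h * L * (q * t))
      + 558 * (h ^ 2 * s ^ 2 * a * L ^ 2) := by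
    calc _ ≤ s * a * (2 * B * L) + (s * a) * (B * L) := by
          have : B * l ≤ 1 * (B * L) := by rw [one_mul]; gcongr
          have h3 : 1 * (B * L) ≤ (s * a) * (B * L) := by gcongr
          have h4 : s * a * (2 * B * lk) ≤ s * a * (2 * B * L) := by gcongr; linarith
          linarith
      _ = 3 * L * (s * a) * B := by ring
      _ ≤ 3 * L * (s * a) * (h * t / q + 186 * (h ^ 2 * s * L)) := by gcongr
      _ = 3 * L * q ^ 2 * (h * t / q) + 558 * (h ^ 2 * s ^ 2 * a * L ^ 2) := by rw [hqq]; ring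
      _ = _ := by
        congr 1
        field_simp
  have h3 : s * a * (2 * h ^ 2) ≤ 2 * (h ^ 2 * s ^ 2 * a * L ^ 2) := by
    calc _ = 2 * (h ^ 2 * (s * 1) * a * 1 ^ 2) := by ring
      _ ≤ 2 * (h ^ 2 * (s * s) * a * L ^ 2) := by gcongr
      _ = _ := by ring
  have h4 : h ^ 2 * l ≤ h ^ 2 * s ^ 2 * a * L ^ 2 := by
    calc _ ≤ h ^ 2 * L := by gcongr
      _ = h ^ 2 * 1 ^ 2 * 1 * (L * 1) := by ring
      _ ≤ h ^ 2 * s ^ 2 * a * (L * L) := by gcongr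
      _ = _ := by ring
  have h5 : 1.25 / E * (h * (s * (h ^ 2 + C * (1 + lk))))
      ≤ 251 * (h ^ 2 * s ^ 2 * a * L ^ 2) := by
    have h6 : C * (1 + lk) ≤ 100 ^ 2 * h ^ 3 * s ^ 2 * a * L ^ 2 * L := by
      rw [hC]
      gcongr
      linarith
    have h7 : h ^ 2 ≤ h ^ 3 * s ^ 2 * a * L ^ 2 * L := by
      calc h ^ 2 = h ^ 2 * 1 * 1 ^ 2 * 1 * 1 ^ 2 * 1 := by ring
        _ ≤ h ^ 2 * h * s ^ 2 * a * L ^ 2 * L := by gcongr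
        _ = _ := by ring
    rw [hE]
    calc _ ≤ 1.25 / (50 * h ^ 2 * s * L) * (h * (s * (h ^ 3 * s ^ 2 * a * L ^ 2 * L
          + 100 ^ 2 * h ^ 3 * s ^ 2 * a * L ^ 2 * L))) := by gcongr
      _ = 250.025 * (h ^ 2 * s ^ 2 * a * L ^ 2) := by field_simp; norm_num
      _ ≤ _ := by linarith
  have h6 : 1.25 / E * h ^ 3 * l ≤ h ^ 2 * s ^ 2 * a * L ^ 2 := by
    rw [hE]
    calc _ ≤ 1.25 / (50 * h ^ 2 * s * L) * h ^ 3 * L := by gcongr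
      _ = 0.025 * h / s := by field_simp; norm_num
      _ ≤ 0.025 * h / 1 := by gcongr
      _ ≤ 1 * (h * 1) * 1 ^ 2 * 1 * 1 ^ 2 := by linarith
      _ ≤ 1 * (h * h) * s ^ 2 * a * L ^ 2 := by gcongr
      _ = _ := by ring
  have h7 : 0 ≤ h * L * (q * t) := by positivity
  nlinarith

end Arithmetic

section Probability

/-- Union bound over events controlled by exponential moments. -/
lemma sum_ite_exists_lt_le {Ω ι : Type*} [Fintype Ω] [Fintype ι] {p : Ω → ℝ}
    (hp : ∀ ω, 0 ≤ p ω) (Z : ι → Ω → ℝ) (hZ : ∀ i, ∑ ω, p ω * Real.exp (Z i ω) ≤ 1) (ℓ : ℝ) :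
    ∑ ω, (if ∃ i, ℓ < Z i ω then p ω else 0) ≤ Fintype.card ι * Real.exp (-ℓ) := by
  have h1 : ∀ ω, (if ∃ i, ℓ < Z i ω then p ω else 0)
      ≤ ∑ i, p ω * Real.exp (Z i ω) * Real.exp (-ℓ) := by
    intro ω
    have h0 : ∀ i, 0 ≤ p ω * Real.exp (Z i ω) * Real.exp (-ℓ) := fun i =>
      mul_nonneg (mul_nonneg (hp ω) (Real.exp_pos _).le) (Real.exp_pos _).le
    split_ifs with h
    · obtain ⟨i, hi⟩ := h
      refine le_trans ?_ (Finset.single_le_sum (fun i _ => h0 i) (Finset.mem_univ i))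
      rw [mul_assoc, ← Real.exp_add]
      exact le_mul_of_one_le_right (hp ω) (Real.one_le_exp (by linarith))
    · exact Finset.sum_nonneg fun i _ => h0 i
  calc _ ≤ ∑ ω, ∑ i, p ω * Real.exp (Z i ω) * Real.exp (-ℓ) := Finset.sum_le_sum fun ω _ => h1 ω
    _ = ∑ i, (∑ ω, p ω * Real.exp (Z i ω)) * Real.exp (-ℓ) := by
      rw [Finset.sum_comm]
      simp_rw [Finset.sum_mul]
    _ ≤ ∑ _i : ι, 1 * Real.exp (-ℓ) :=
      Finset.sum_le_sum fun i _ => mul_le_mul_of_nonneg_right (hZ i) (Real.exp_pos _).le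
    _ = _ := by simp

lemma expSum_div {S : Type*} [Fintype S] (q w : ℕ → S → S → ℝ) (b : ℝ) (j : ℕ) (x : S) :
    expSum q (fun j x y => w j x y / b) j x = expSum q w j x / b := by
  induction j generalizing x with
  | zero => simp [expSum]
  | succ j ih =>
    simp only [expSum, ih, ← add_div, Finset.sum_div, mul_div_assoc]

variable {S A : Type*} [Fintype S] [Fintype A] [DecidableEq S] [DecidableEq A]
  [Nonempty S] [Nonempty A]
  {P : S → A → S → ℝ} {R : S → A → ℝ} {H K : ℕ}
  {bonus : (S → A → ℕ) → (S → A → S → ℝ) → (ℕ → S → ℕ) → ℕ → (S → ℝ) → S → A → ℝ}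
  {xinit : Fin K → S}

lemma sum_ite_not_concentrate_le (hH : 1 ≤ H) {L Λ : ℝ} (hΛ : 18 * (H : ℝ) ^ 2 ≤ Λ)
    (hP0 : ∀ x a y, 0 ≤ P x a y) (hP1 : ∀ x a, ∑ y, P x a y = 1)
    (hR0 : ∀ x a, 0 ≤ R x a) (hR1 : ∀ x a, R x a ≤ 1) :
    ∑ ω, (if TransitionsConcentrate P R H bonus ω L Λ then 0
        else trajProb P R H K bonus xinit ω)
      ≤ (K * (Fintype.card S * (Fintype.card A * (H * (Nat.log 2 (K * H) + 1)))) : ℝ)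
          * Real.exp (-(5 / 4 * L))
        + (K * (Fintype.card S * (Fintype.card A * H)) : ℝ) * Real.exp (-(2 * L))
        + (K * (Fintype.card S * (Fintype.card A * Fintype.card S)) : ℝ)
          * Real.exp (-(2 * L)) := by
  have hH1 : (1 : ℝ) ≤ H := by exact_mod_cast hH
  have hp : ∀ ω, 0 ≤ trajProb P R H K bonus xinit ω := fun ω =>
    trajProb_nonneg R H K bonus xinit ω hP0
  have hV0 : ∀ j y, 0 ≤ VstarJ P R j y := VstarJ_nonneg hP0 hR0
  have hV1 : ∀ j < H, ∀ y, VstarJ P R j y ≤ H := fun j hj y =>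
    (VstarJ_le hP0 hP1 hR1 j y).trans (by exact_mod_cast hj.le)
  have h1 := sum_ite_exists_lt_le hp
    (fun (i : Fin K × S × A × Fin H × Fin (Nat.log 2 (K * H) + 1)) ω =>
      ∑ y, (transitions R H K bonus ω i.1 i.2.1 i.2.2.1 y : ℝ)
      * (1 / (2 * (H : ℝ) * 2 ^ i.2.2.2.2.val)
          * (∑ z, P i.2.1 i.2.2.1 z * VstarJ P R i.2.2.2.1 z - VstarJ P R i.2.2.2.1 y)
        - (1 / 2 + 7 / 12 * (1 / (2 * (H : ℝ) * 2 ^ i.2.2.2.2.val) * H))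
          * (1 / (2 * (H : ℝ) * 2 ^ i.2.2.2.2.val)) ^ 2
          * (∑ z, P i.2.1 i.2.2.1 z * VstarJ P R i.2.2.2.1 z - VstarJ P R i.2.2.2.1 y) ^ 2))
    (by
      rintro ⟨k, x, a, j, i⟩
      refine sum_trajProb_exp_transitions_le R H bonus xinit hP0 hP1 x a _ ?_ k k.isLt.le
      refine sum_exp_selfNormalized_le (hP0 x a) (hP1 x a) (hV0 j) (hV1 j j.isLt) (by positivity) ?_
      have h2 : (1 : ℝ) ≤ 2 ^ i.val := one_le_pow₀ (by norm_num)
      rw [one_div_mul_eq_div, div_le_div_iff₀ (by positivity) (by norm_num)]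
      nlinarith) (5 / 4 * L)
  have h2 := sum_ite_exists_lt_le hp
    (fun (i : Fin K × S × A × Fin H) ω =>
      ∑ y, (transitions R H K bonus ω i.1 i.2.1 i.2.2.1 y : ℝ)
      * (1 / Λ * (VstarJ P R i.2.2.2 y - ∑ z, P i.2.1 i.2.2.1 z * VstarJ P R i.2.2.2 z)
        - (1 / Λ) ^ 2 * wvar (P i.2.1 i.2.2.1) (VstarJ P R i.2.2.2)))
    (by
      rintro ⟨k, x, a, j⟩
      refine sum_trajProb_exp_transitions_le R H bonus xinit hP0 hP1 x a _ ?_ k k.isLt.le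
      have hΛ1 : (H : ℝ) ≤ Λ := by nlinarith
      refine sum_exp_bernstein_le (hP0 x a) (hP1 x a) (hV0 j) (hV1 j j.isLt)
        (one_div_nonneg.2 (by linarith)) ?_
      rw [one_div_mul_eq_div]
      exact div_le_one_of_le₀ hΛ1 (by linarith)) (2 * L)
  have h3 := sum_ite_exists_lt_le hp
    (fun (i : Fin K × S × A × S) ω =>
      ∑ y', (transitions R H K bonus ω i.1 i.2.1 i.2.2.1 y' : ℝ)
      * (1 / (4 * (H : ℝ)) * (if y' = i.2.2.2 then 1 else 0)
        - (1 / (4 * (H : ℝ)) + (1 / (4 * (H : ℝ))) ^ 2) * P i.2.1 i.2.2.1 i.2.2.2))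
    (by
      rintro ⟨k, x, a, y⟩
      refine sum_trajProb_exp_transitions_le R H bonus xinit hP0 hP1 x a _ ?_ k k.isLt.le
      exact sum_exp_indicator_le (hP0 x a) (hP1 x a) (by positivity)
        (div_le_one_of_le₀ (by linarith) (by positivity)) y) (2 * L)
  simp only [Fintype.card_prod, Fintype.card_fin, Nat.cast_mul, Nat.cast_add, Nat.cast_one]
    at h1 h2 h3
  refine le_trans ?_ (add_le_add (add_le_add h1 h2) h3)
  simp_rw [← Finset.sum_add_distrib]
  refine Finset.sum_le_sum fun ω _ => ?_
  by_cases hc : TransitionsConcentrate P R H bonus ω L Λ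
  · rw [if_pos hc]
    have := hp ω
    split_ifs <;> linarith
  · rw [if_neg hc]
    have hpω := hp ω
    split_ifs with g1 g2 g3 g3 g2 g3 g3
    all_goals try linarith
    push Not at g1 g2 g3
    exact absurd ⟨fun k hk x a j hj i hi => g1 (⟨k, hk⟩, x, a, ⟨j, hj⟩, ⟨i, hi⟩),
      fun k hk x a j hj => g2 (⟨k, hk⟩, x, a, ⟨j, hj⟩), fun k hk x a y => g3 (⟨k, hk⟩, x, a, y)⟩ hc

/-- The expected costs are dominated by the realized costs with high probability. -/
lemma sum_ite_expSum_gt_le (hH : 1 ≤ H) {B E C L : ℝ} (hB : 0 ≤ B) (hE : 0 < E) (hC : 0 ≤ C)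
    (hP0 : ∀ x a y, 0 ≤ P x a y) (hP1 : ∀ x a, ∑ y, P x a y = 1) :
    ∑ ω, (if ∑ k : Fin K, expSum (epKernel P R H K bonus ω k) (epCost R H bonus ω B E C k) H (xinit k)
          ≤ 8 / 5 * (∑ k : Fin K, pathSum (epCost R H bonus ω B E C k) H (ω k)
            + (B + (H : ℝ) ^ 2 + 1.25 / E * (H : ℝ) ^ 3) * L) then 0
        else trajProb P R H K bonus xinit ω) ≤ Real.exp (-L) := by
  have hH0 : (0 : ℝ) < H := by exact_mod_cast hH
  obtain ⟨b, hb⟩ : ∃ b, b = B + (H : ℝ) ^ 2 + 1.25 / E * (H : ℝ) ^ 3 := ⟨_, rfl⟩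
  have hb0 : 0 < b := by rw [hb]; positivity
  rw [← hb]
  have hps : ∀ (ω : Fin K → Fin (H + 1) → S) k τ,
      pathSum (fun j x y => epCost R H bonus ω B E C k j x y / b) H τ
        = pathSum (epCost R H bonus ω B E C k) H τ / b := fun ω k τ => by
    unfold pathSum
    rw [Finset.sum_div]
  have h1 := sum_ite_exists_lt_le (ι := Unit) (p := fun ω => trajProb P R H K bonus xinit ω)
    (fun ω => trajProb_nonneg R H K bonus xinit ω hP0) _
    (fun _ => sum_trajProb_exp_episodes_le R H K bonus xinit hP0 hP1
      (fun ω k j x y => epCost R H bonus ω B E C k j x y / b)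
      (fun ω m τ k hk => by rw [epCost_update B E C m τ k hk])
      (fun ω k τ => by
        rw [hps]
        exact div_nonneg (Finset.sum_nonneg fun p _ => epCost_nonneg hB hE hC _ _ _ _) hb0.le)
      (fun ω k τ => by
        rw [hps, div_le_one hb0, hb]
        exact pathSum_epCost_le hH hB hE k τ)) L
  simp only [Fintype.card_unit, Nat.cast_one, one_mul, exists_const, hps, expSum_div] at h1
  refine le_trans (Finset.sum_le_sum fun ω _ => ?_) h1
  have hp := trajProb_nonneg R H K bonus xinit ω hP0
  split_ifs with h2 h3 h3
  · exact hp
  · exact le_rfl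
  · exact le_rfl
  · exfalso
    refine h2 ?_
    push Not at h3
    simp_rw [← mul_div_assoc, ← sub_div] at h3
    rw [← Finset.sum_div, Finset.sum_sub_distrib, ← Finset.mul_sum, div_le_iff₀ hb0] at h3
    linarith

/-- The failure probabilities of the concentration events sum to less than `δ`. -/
lemma failure_le {h s a k δ : ℝ} (hh : 1 ≤ h) (hs : 1 ≤ s) (ha : 1 ≤ a) (hk : 1 ≤ k)
    (hδ0 : 0 < δ) (hδ1 : δ < 1) {n : ℕ} (hn : (2 : ℝ) ^ n ≤ k * h) {L : ℝ}
    (hL : L = Real.log (5 * s * a * (k * h) / δ)) :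
    (k * (s * (a * (h * (n + 1))))) * Real.exp (-(5 / 4 * L))
        + (k * (s * (a * h))) * Real.exp (-(2 * L)) + (k * (s * (a * s))) * Real.exp (-(2 * L))
        + Real.exp (-L) ≤ δ := by
  have hsa : 1 ≤ s * a := one_le_mul_of_one_le_of_one_le hs ha
  have hkh : 1 ≤ k * h := one_le_mul_of_one_le_of_one_le hk hh
  have hM : k * h ≤ s * a * (k * h) / δ := by
    rw [le_div_iff₀ hδ0]
    nlinarith
  have hpos : 0 < 5 * s * a * (k * h) / δ := by positivity
  have hexp : Real.exp (-L) = δ / (5 * s * a * (k * h)) := by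
    rw [hL, Real.exp_neg, Real.exp_log hpos, inv_div]
  have hnL : (n + 2) * Real.log 2 ≤ L := by
    have : ((n + 2 : ℕ) : ℝ) * Real.log 2 = Real.log (2 ^ (n + 2)) := by rw [Real.log_pow]
    push_cast at this
    rw [this, hL]
    refine Real.log_le_log (by positivity) ?_
    have h5 : 5 * s * a * (k * h) / δ = 5 * (s * a * (k * h) / δ) := by ring
    rw [h5, pow_add]
    nlinarith
  have hlog2 := Real.log_two_gt_d9
  have hL0 : 0 ≤ L := le_trans (by positivity) hnL
  obtain ⟨u, hu⟩ : ∃ u, u = L / 4 := ⟨_, rfl⟩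
  have hu0 : 0 ≤ u := by rw [hu]; positivity
  have hcube : 1 + u + u ^ 2 / 2 + u ^ 3 / 6 ≤ Real.exp u := by
    have := Real.sum_le_exp_of_nonneg hu0 4
    simp only [Finset.sum_range_succ, Finset.sum_range_zero, Nat.factorial] at this
    norm_num at this
    linarith
  have hn2 : (n : ℝ) + 1 ≤ 2 * Real.exp u := by
    have h1 : ((n : ℝ) + 2) * 0.69314 ≤ 4 * u := by
      rw [hu]
      nlinarith
    have h2 : (n : ℝ) + 1 ≤ 5.78 * u - 1 := by nlinarith
    have h3 : 0 ≤ u ^ 3 / 3 + u ^ 2 - 3.78 * u + 3 := by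
      nlinarith [mul_nonneg hu0 (sq_nonneg (u - 1.2)), sq_nonneg (u - 1.2)]
    linarith
  have h1 : (k * (s * (a * (h * (n + 1))))) * Real.exp (-(5 / 4 * L)) ≤ 2 * δ / 5 := by
    have h2 : Real.exp (-(5 / 4 * L)) = Real.exp (-L) * Real.exp (-u) := by
      rw [← Real.exp_add, hu]
      ring_nf
    have h3 : (k * (s * (a * (h * (n + 1))))) * Real.exp (-(5 / 4 * L))
        = δ / 5 * ((n + 1) * Real.exp (-u)) := by
      rw [h2, hexp]
      field_simp
    have h4 : ((n : ℝ) + 1) * Real.exp (-u) ≤ 2 := by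
      rw [Real.exp_neg, ← div_eq_mul_inv, div_le_iff₀ (Real.exp_pos u)]
      exact hn2
    rw [h3]
    nlinarith
  have h2e : Real.exp (-(2 * L)) = Real.exp (-L) * Real.exp (-L) := by
    rw [← Real.exp_add]
    ring_nf
  have hsakh : 1 ≤ s * a * (k * h) := one_le_mul_of_one_le_of_one_le hsa hkh
  have hq : Real.exp (-L) ≤ δ / 5 := by
    rw [hexp]
    gcongr
    linarith
  have h2 : (k * (s * (a * h))) * Real.exp (-(2 * L)) ≤ δ / 5 := by
    have : (k * (s * (a * h))) * Real.exp (-(2 * L)) = δ / 5 * Real.exp (-L) := by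
      rw [h2e]
      nth_rewrite 1 [hexp]
      field_simp
    rw [this]
    nlinarith
  have h3 : (k * (s * (a * s))) * Real.exp (-(2 * L)) ≤ δ / 5 := by
    have h4 : (k * (s * (a * s))) * Real.exp (-(2 * L))
        = δ / 5 * (δ / (5 * a * k * h ^ 2)) := by
      rw [h2e, hexp]
      field_simp
    have h5 : δ / (5 * a * k * h ^ 2) ≤ 1 := by
      refine div_le_one_of_le₀ ?_ (by positivity)
      calc δ ≤ 5 * 1 * 1 * 1 ^ 2 := by linarith
        _ ≤ _ := by gcongr
    rw [h4]
    nlinarith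
  linarith

end Probability

section Main

variable {S A : Type*} [Fintype S] [Fintype A] [DecidableEq S] [DecidableEq A]
  [Nonempty S] [Nonempty A]

/-- Deterministic regret bound on the good event. -/
lemma ucbviRegret_le_of_concentrate {P : S → A → S → ℝ} {R : S → A → ℝ} {H K : ℕ}
    {bonus : (S → A → ℕ) → (S → A → S → ℝ) → (ℕ → S → ℕ) → ℕ → (S → ℝ) → S → A → ℝ}
    {xinit : Fin K → S} {ω : Fin K → Fin (H + 1) → S} {L Λ E B C : ℝ}
    (hb : bonus = bonusBF H (Fintype.card S) (Fintype.card A) L) (hL : 1 / 4 ≤ L) (hH : 1 ≤ H)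
    (hK : 1 ≤ K) (hΛ : 18 * (H : ℝ) ^ 2 ≤ Λ) (hE : 0 < E)
    (hP0 : ∀ x a y, 0 ≤ P x a y) (hP1 : ∀ x a, ∑ y, P x a y = 1)
    (hR0 : ∀ x a, 0 ≤ R x a) (hR1 : ∀ x a, R x a ≤ 1)
    (hC : C = 100 ^ 2 * (H : ℝ) ^ 3 * (Fintype.card S : ℝ) ^ 2 * (Fintype.card A : ℝ) * L ^ 2)
    (hB : B = invCoef (Fintype.card S) H L Λ E)
    (hω : TransitionsConcentrate P R H bonus ω L Λ)
    (hsum : ∑ k : Fin K, expSum (epKernel P R H K bonus ω k) (epCost R H bonus ω B E C k) H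
        (xinit k) ≤ 8 / 5 * (∑ k : Fin K, pathSum (epCost R H bonus ω B E C k) H (ω k)
            + (B + (H : ℝ) ^ 2 + 1.25 / E * (H : ℝ) ^ 3) * L)) :
    ucbviRegret P R H K bonus xinit ω
      ≤ 1.65 * (K * (4.5 / Λ * ((H : ℝ) ^ 2 / 4))
        + 8 / 5 * ((Fintype.card S * Fintype.card A * (2 * (H : ℝ) ^ 2 + 2 * B * Real.log K)
          + 1.25 / E * (H * (Fintype.card S * ((H : ℝ) ^ 2 + C * (1 + Real.log K)))))
        + (B + (H : ℝ) ^ 2 + 1.25 / E * (H : ℝ) ^ 3) * L)) := by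
  have hB0 : 0 ≤ B := by
    rw [hB]
    exact invCoef_nonneg (by positivity) (by positivity) (by linarith)
      (le_trans (by positivity) hΛ) hE.le
  have hC0 : 0 ≤ C := by rw [hC]; positivity
  have h1 := sum_pathSum_epCost_le (R := R) (bonus := bonus) (ω := ω) hH hK hB0 hE hC0
  have h2 : ucbviRegret P R H K bonus xinit ω
      ≤ ∑ k : Fin K, 1.65 * (4.5 / Λ * ((H : ℝ) ^ 2 / 4)
        + expSum (epKernel P R H K bonus ω k) (epCost R H bonus ω B E C k) H (xinit k)) := by
    refine Finset.sum_le_sum fun k _ => ?_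
    rw [hB, hC]
    exact VstarJ_sub_VpolJ_le hb hL hH hΛ hE hP0 hP1 hR0 hR1 hω k.isLt (xinit k)
  rw [← Finset.mul_sum, Finset.sum_add_distrib, Finset.sum_const, Finset.card_univ,
    Fintype.card_fin, nsmul_eq_mul] at h2
  refine h2.trans ?_
  gcongr
  refine hsum.trans ?_
  gcongr

/-- regret bound for UCBVI-BF.  With probability at least `1 − δ` over the
interaction histories (the probability of an event being the sum of `trajProb` over the
histories in it), the regret after `K` episodes satisfies
`Regret(K) ≤ 30·H·L·√(S·A·K) + 2500·H²·S²·A·L² + 4·H^{3/2}·√(K·L)` where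
`L = ln(5·H·S·A·T/δ)` and `T = K·H`. -/
theorem ucbvi_bf_regret_bound
    (P : S → A → S → ℝ) (R : S → A → ℝ) (H K : ℕ) (hH : 1 ≤ H) (hK : 1 ≤ K)
    (hP0 : ∀ x a y, 0 ≤ P x a y) (hP1 : ∀ x a, ∑ y, P x a y = 1)
    (hR0 : ∀ x a, 0 ≤ R x a) (hR1 : ∀ x a, R x a ≤ 1)
    (δ : ℝ) (hδ0 : 0 < δ) (hδ1 : δ < 1) (xinit : Fin K → S) :
    1 - δ ≤ ∑ ω : Fin K → Fin (H + 1) → S,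
      (if ucbviRegret P R H K
            (bonusBF H (Fintype.card S) (Fintype.card A)
              (Real.log (5 * (Fintype.card S : ℝ) * (Fintype.card A : ℝ)
                * ((K : ℝ) * (H : ℝ)) / δ)))
            xinit ω
          ≤ 30 * (H : ℝ)
              * Real.log (5 * (H : ℝ) * (Fintype.card S : ℝ) * (Fintype.card A : ℝ)
                  * ((K : ℝ) * (H : ℝ)) / δ)
              * Real.sqrt ((Fintype.card S : ℝ) * (Fintype.card A : ℝ) * (K : ℝ))
            + 2500 * (H : ℝ) ^ 2 * (Fintype.card S : ℝ) ^ 2 * (Fintype.card A : ℝ)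
              * (Real.log (5 * (H : ℝ) * (Fintype.card S : ℝ) * (Fintype.card A : ℝ)
                  * ((K : ℝ) * (H : ℝ)) / δ)) ^ 2
            + 4 * Real.sqrt ((H : ℝ) ^ 3)
              * Real.sqrt ((K : ℝ)
                * Real.log (5 * (H : ℝ) * (Fintype.card S : ℝ) * (Fintype.card A : ℝ)
                    * ((K : ℝ) * (H : ℝ)) / δ))
        then trajProb P R H K
            (bonusBF H (Fintype.card S) (Fintype.card A)
              (Real.log (5 * (Fintype.card S : ℝ) * (Fintype.card A : ℝ)
                * ((K : ℝ) * (H : ℝ)) / δ)))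
            xinit ω
        else 0) := by
  have hs : (1 : ℝ) ≤ Fintype.card S := by exact_mod_cast Fintype.card_pos (α := S)
  have ha : (1 : ℝ) ≤ Fintype.card A := by exact_mod_cast Fintype.card_pos (α := A)
  have hh : (1 : ℝ) ≤ H := by exact_mod_cast hH
  have hk : (1 : ℝ) ≤ K := by exact_mod_cast hK
  obtain ⟨l, hl⟩ : ∃ l, l = Real.log (5 * (Fintype.card S : ℝ) * (Fintype.card A : ℝ)
      * ((K : ℝ) * (H : ℝ)) / δ) := ⟨_, rfl⟩
  obtain ⟨L, hLdef⟩ : ∃ L, L = Real.log (5 * (H : ℝ) * (Fintype.card S : ℝ) * (Fintype.card A : ℝ)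
      * ((K : ℝ) * (H : ℝ)) / δ) := ⟨_, rfl⟩
  rw [← hl, ← hLdef]
  obtain ⟨bonus, hb⟩ : ∃ b : (S → A → ℕ) → (S → A → S → ℝ) → (ℕ → S → ℕ) → ℕ → (S → ℝ) → S → A → ℝ,
    b = bonusBF H (Fintype.card S) (Fintype.card A) l := ⟨_, rfl⟩
  rw [← hb]
  have hlL : l ≤ L := by
    rw [hl, hLdef]
    refine Real.log_le_log (by positivity) ?_
    gcongr ?_ * _ * _ / _
    nlinarith
  have hlk0 : 0 ≤ Real.log K := Real.log_nonneg hk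
  have hlk : 1 + Real.log K ≤ l := by
    rw [hl, ← Real.log_exp 1, ← Real.log_mul (Real.exp_pos 1).ne' (by positivity)]
    refine Real.log_le_log (by positivity) ?_
    rw [le_div_iff₀ hδ0]
    have he : Real.exp 1 ≤ 5 := Real.exp_one_lt_d9.le.trans (by norm_num)
    calc Real.exp 1 * K * δ ≤ 5 * K * 1 := by gcongr
      _ = 5 * 1 * 1 * (K * 1) := by ring
      _ ≤ _ := by gcongr
  have hl1 : 1 ≤ l := by linarith
  have hL1 : 1 ≤ L := hl1.trans hlL
  obtain ⟨Λ, hΛ⟩ : ∃ Λ, Λ = (H : ℝ) * √(K : ℝ)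
    / (4 * L * √((Fintype.card S : ℝ) * Fintype.card A)) + 18 * (H : ℝ) ^ 2 := ⟨_, rfl⟩
  obtain ⟨E, hE⟩ : ∃ E, E = 50 * (H : ℝ) ^ 2 * Fintype.card S * L := ⟨_, rfl⟩
  obtain ⟨C, hC⟩ : ∃ C, C = 100 ^ 2 * (H : ℝ) ^ 3 * (Fintype.card S : ℝ) ^ 2
    * (Fintype.card A : ℝ) * l ^ 2 := ⟨_, rfl⟩
  obtain ⟨B, hB⟩ : ∃ B, B = invCoef (Fintype.card S) H l Λ E := ⟨_, rfl⟩
  have hΛ18 : 18 * (H : ℝ) ^ 2 ≤ Λ := by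
    rw [hΛ]
    exact le_add_of_nonneg_left (by positivity)
  have hE0 : 0 < E := by rw [hE]; positivity
  have hC0 : 0 ≤ C := by rw [hC]; positivity
  have hB0 : 0 ≤ B := by
    rw [hB]
    exact invCoef_nonneg (by positivity) (by positivity) (by linarith)
      (le_trans (by positivity) hΛ18) hE0.le
  have hn : (2 : ℝ) ^ Nat.log 2 (K * H) ≤ K * H := by
    exact_mod_cast Nat.pow_log_le_self 2 (Nat.mul_pos hK hH).ne'
  have hfail := failure_le hh hs ha hk hδ0 hδ1 hn hl
  have hbad1 := sum_ite_not_concentrate_le (bonus := bonus) (xinit := xinit) (L := l) hH hΛ18 hP0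
    hP1 hR0 hR1
  have hbad2 := sum_ite_expSum_gt_le (R := R) (bonus := bonus) (xinit := xinit) (L := l) hH hB0 hE0
    hC0 hP0 hP1
  have hone := sum_trajProb R H K bonus xinit hP1
  rw [sub_le_iff_le_add]
  refine le_trans ?_ (add_le_add_right ((add_le_add hbad1 hbad2).trans hfail) _)
  rw [← hone, ← Finset.sum_add_distrib, ← Finset.sum_add_distrib]
  refine Finset.sum_le_sum fun ω _ => ?_
  have hp := trajProb_nonneg R H K bonus xinit ω hP0
  by_cases hc : TransitionsConcentrate P R H bonus ω l Λ
  · by_cases hsum : ∑ k : Fin K, expSum (epKernel P R H K bonus ω k) (epCost R H bonus ω B E C k) H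
        (xinit k) ≤ 8 / 5 * (∑ k : Fin K, pathSum (epCost R H bonus ω B E C k) H (ω k)
            + (B + (H : ℝ) ^ 2 + 1.25 / E * (H : ℝ) ^ 3) * l)
    · have hreg := ucbviRegret_le_of_concentrate hb (by linarith) hH hK hΛ18 hE0 hP0 hP1 hR0 hR1
        hC hB hc hsum
      have harith := regret_arith hh hs ha hk hl1 hlL hlk0 hlk hΛ hE hC hB
      rw [if_pos hc, if_pos hsum, if_pos]
      · simp
      · exact (hreg.trans harith).trans (le_add_of_nonneg_right (by positivity))
    · rw [if_neg hsum]
      split_ifs <;> linarith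
  · rw [if_neg hc]
    split_ifs <;> linarith

end Main
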